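/- arXiv:1501.00464 — 3 statements merged into one kernel-verified Lean document; each statement's English description precedes it below -/
import Mathlib

section
/- Let p(z_1, ..., z_m) be a real stable polynomial and x ∈ ℝ^m such that p has no zeros in the set {y ∈ ℝ^m : y_i ≥ x_i for all i}. Then for every integer k ≥ 0, all indices 1 ≤ i, j ≤ m, and every x' ∈ ℝ^m with x' ≥ x coordinatewise, one has (-1)^k (∂_j)^k Φ_p^i (x') ≥ 0. In particular, for each canonical basis vector e_j of ℝ^m, the function t ↦ Φ_p^i(x + t e_j) is nonnegative, nonincreasing, and convex on [0, ∞). -/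
open MvPolynomial

/-- A polynomial in `m` complex variables is *real stable* if all its coefficients are
real and it has no zeros in `ℍ^m`, where `ℍ` is the open upper half-plane. -/
def RealStable {m : ℕ} (p : MvPolynomial (Fin m) ℂ) : Prop :=
  (∀ c : Fin m →₀ ℕ, ∃ r : ℝ, MvPolynomial.coeff c p = (r : ℂ)) ∧
  ∀ w : Fin m → ℂ, (∀ i, 0 < (w i).im) → MvPolynomial.eval w p ≠ 0

/-- The barrier function `Φ_p^i(y) = (∂_i p)(y) / p(y)` of `p` in direction `i`,
evaluated at a real point `y` (for `p` with real coefficients the value is real, and we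
take the real part). -/
noncomputable def barrier {m : ℕ} (p : MvPolynomial (Fin m) ℂ) (i : Fin m)
    (y : Fin m → ℝ) : ℝ :=
  ((MvPolynomial.eval (fun l => ((y l : ℂ))) (MvPolynomial.pderiv i p)) /
    (MvPolynomial.eval (fun l => ((y l : ℂ))) p)).re

section Pole

open Filter Topology

/-- A pole at a real point of a function whose imaginary part is bounded above near that point in
the upper half-plane is simple with positive residue, provided its leading coefficient is real. -/
theorem simple_pole_of_im_le {n : ℕ} (hn : 1 ≤ n) {y A C : ℝ} (hA : A ≠ 0) {g : ℂ → ℂ}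
    (hg : ContinuousAt g y) (hgy : g y = A)
    (hC : ∀ᶠ z in 𝓝 (y : ℂ), 0 < z.im → (g z / (z - y) ^ n).im ≤ C) : n = 1 ∧ 0 < A := by
  have key : ∀ θ : ℝ, 0 < θ → θ < Real.pi → 0 ≤ A * Real.sin (n * θ) := by
    intro θ h0 h1
    have hs : 0 < Real.sin θ := Real.sin_pos_of_pos_of_lt_pi h0 h1
    let ω : ℂ := Complex.exp (θ * Complex.I)
    have hωim : ω.im = Real.sin θ := Complex.exp_ofReal_mul_I_im θ
    have hω0 : ω ≠ 0 := Complex.exp_ne_zero _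
    have hωn : (ω ^ n)⁻¹ = Complex.exp ((-(n * θ) : ℝ) * Complex.I) := by
      rw [← Complex.exp_nat_mul, ← Complex.exp_neg]; congr 1; push_cast; ring
    let γ : ℝ → ℂ := fun ε => y + ε * ω
    have hγ : Tendsto γ (𝓝[>] 0) (𝓝 (y : ℂ)) := by
      have : Continuous γ := by fun_prop
      have h := this.tendsto 0
      simp only [γ, Complex.ofReal_zero, zero_mul, add_zero] at h
      exact h.mono_left nhdsWithin_le_nhds
    have hl : Tendsto (fun ε => (g (γ ε) * (ω ^ n)⁻¹).im) (𝓝[>] 0) (𝓝 ((A * (ω ^ n)⁻¹).im)) := by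
      rw [← hgy]
      exact (Complex.continuous_im.tendsto _).comp ((hg.tendsto.comp hγ).mul_const _)
    have hr : Tendsto (fun ε : ℝ => C * ε ^ n) (𝓝[>] 0) (𝓝 0) := by
      have : Continuous (fun ε : ℝ => C * ε ^ n) := by fun_prop
      have h := this.tendsto 0
      rw [zero_pow (by omega), mul_zero] at h
      exact h.mono_left nhdsWithin_le_nhds
    have hle : (A * (ω ^ n)⁻¹).im ≤ 0 := by
      refine le_of_tendsto_of_tendsto hl hr ?_
      filter_upwards [hγ.eventually hC, self_mem_nhdsWithin] with ε h hε
      have hε : 0 < ε := hε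
      have him : 0 < (γ ε).im := by
        simp only [γ, Complex.add_im, Complex.ofReal_im, Complex.im_ofReal_mul, hωim, zero_add]
        positivity
      have h2 := h him
      have e : g (γ ε) / (γ ε - y) ^ n = ((ε ^ n)⁻¹ : ℝ) * (g (γ ε) * (ω ^ n)⁻¹) := by
        simp only [γ, add_sub_cancel_left, mul_pow]
        push_cast
        field_simp
      rw [e, Complex.im_ofReal_mul, inv_mul_le_iff₀ (by positivity)] at h2
      linarith
    rw [hωn, Complex.im_ofReal_mul, Complex.exp_ofReal_mul_I_im, Real.sin_neg] at hle
    linarith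
  have hn' : (0 : ℝ) < n := by exact_mod_cast hn
  have hpi := Real.pi_pos
  have h1 : n = 1 := by
    by_contra hne
    have h2 : (2 : ℝ) ≤ n := by exact_mod_cast (by omega : 2 ≤ n)
    have a := key (Real.pi / (2 * n)) (by positivity) (by
      rw [div_lt_iff₀ (by positivity)]; nlinarith)
    have b := key (3 * Real.pi / (2 * n)) (by positivity) (by
      rw [div_lt_iff₀ (by positivity)]; nlinarith)
    rw [show (n : ℝ) * (Real.pi / (2 * n)) = Real.pi / 2 by field_simp, Real.sin_pi_div_two] at a
    rw [show (n : ℝ) * (3 * Real.pi / (2 * n)) = Real.pi / 2 + Real.pi by field_simp; ring,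
      Real.sin_add_pi, Real.sin_pi_div_two] at b
    exact hA (by linarith)
  subst h1
  refine ⟨rfl, lt_of_le_of_ne ?_ hA.symm⟩
  have a := key (Real.pi / 2) (by positivity) (by linarith)
  simpa using a

end Pole

namespace Polynomial

open Filter Topology

/-- Partial fractions of a real rational function with real poles whose imaginary part is bounded
above in the upper half-plane near each pole: all poles are simple, with nonnegative residues. -/
theorem exists_partialFraction_nonneg (d : ℕ) : ∀ P Q : ℝ[X], P.natDegree = d → P ≠ 0 →
    (∀ z : ℂ, aeval z P = 0 → z.im = 0) →
    (∀ y : ℝ, P.eval y = 0 → ∃ C : ℝ, ∀ᶠ z in 𝓝 (y : ℂ), 0 < z.im →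
      (aeval z Q / aeval z P).im ≤ C) →
    ∃ (S : Finset ℝ) (c : ℝ → ℝ) (L : ℝ[X]), (∀ y ∈ S, P.eval y = 0 ∧ 0 ≤ c y) ∧
      ∀ z : ℂ, aeval z P ≠ 0 →
        aeval z Q / aeval z P = aeval z L + ∑ y ∈ S, (c y : ℂ) / (z - y) := by
  induction d using Nat.strong_induction_on with
  | _ d ih =>
  intro P Q hd hP0 hreal hbd
  rcases Nat.eq_zero_or_pos d with rfl | hdpos
  · obtain ⟨a, rfl⟩ := natDegree_eq_zero.mp hd
    refine ⟨∅, 0, Q * C a⁻¹, by simp, fun z hz => ?_⟩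
    simp [div_eq_mul_inv]
  · obtain ⟨w, hw⟩ := Complex.exists_root (f := P.map (algebraMap ℝ ℂ)) (by
      rw [degree_map]; exact natDegree_pos_iff_degree_pos.mp (hd ▸ hdpos))
    have hw' : aeval w P = 0 := by simpa [aeval_def, eval_map] using hw
    obtain ⟨y, rfl⟩ : ∃ y : ℝ, (y : ℂ) = w := ⟨w.re, Complex.ext rfl (hreal w hw').symm⟩
    have haev : ∀ (R : ℝ[X]) (t : ℝ), aeval (t : ℂ) R = ((R.eval t : ℝ) : ℂ) := fun R t =>
      aeval_ofReal (K := ℂ) R t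
    have hy : P.eval y = 0 := by rw [haev] at hw'; exact_mod_cast hw'
    by_cases hQy : Q.eval y = 0
    · obtain ⟨P₁, rfl⟩ := dvd_iff_isRoot.mpr hy
      obtain ⟨Q₁, rfl⟩ := dvd_iff_isRoot.mpr hQy
      have hP₁ : P₁ ≠ 0 := right_ne_zero_of_mul hP0
      have hdeg : P₁.natDegree < d := by
        rw [← hd, natDegree_mul (X_sub_C_ne_zero y) hP₁, natDegree_X_sub_C]; omega
      have hcancel : ∀ z : ℂ, z - y ≠ 0 →
          aeval z ((X - C y) * Q₁) / aeval z ((X - C y) * P₁) = aeval z Q₁ / aeval z P₁ := by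
        intro z hz
        simp only [map_mul, map_sub, aeval_X, aeval_C, Complex.coe_algebraMap]
        exact mul_div_mul_left _ _ hz
      obtain ⟨S, c, L, hS, hf⟩ := ih _ hdeg P₁ Q₁ rfl hP₁ (fun z hz => hreal z (by simp [hz]))
        (fun t ht => by
          obtain ⟨B, hB⟩ := hbd t (by simp [ht])
          refine ⟨B, hB.mono fun z hz hzi => ?_⟩
          rw [← hcancel z (fun h => by
            have := congrArg Complex.im h
            simp at this; linarith)]
          exact hz hzi)
      refine ⟨S, c, L, fun t ht => ⟨by simp [(hS t ht).1], (hS t ht).2⟩, fun z hz => ?_⟩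
      have hz' : (z - y) * aeval z P₁ ≠ 0 := by simpa using hz
      rw [hcancel z (left_ne_zero_of_mul hz')]
      exact hf z (right_ne_zero_of_mul hz')
    · obtain ⟨R, hPR, hR⟩ := exists_eq_pow_rootMultiplicity_mul_and_not_dvd P hP0 y
      have hRy : R.eval y ≠ 0 := fun h => hR (dvd_iff_isRoot.mpr h)
      obtain ⟨B, hB⟩ := hbd y hy
      have hsimple := simple_pole_of_im_le (n := P.rootMultiplicity y) (y := y) (C := B)
        (A := Q.eval y / R.eval y) (g := fun z => aeval z Q / aeval z R)
        ((rootMultiplicity_pos hP0).mpr hy) (div_ne_zero hQy hRy)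
        (ContinuousAt.div (Polynomial.continuous_aeval Q).continuousAt
          (Polynomial.continuous_aeval R).continuousAt (by rw [haev]; exact_mod_cast hRy))
        (by simp only [haev]; push_cast; rfl)
        (hB.mono fun z hz hzi => by
          have := hz hzi
          have e : aeval z P = (z - y) ^ P.rootMultiplicity y * aeval z R := by
            conv_lhs => rw [hPR]
            simp
          rwa [e, mul_comm, ← div_div] at this)
      obtain ⟨h1, hA⟩ := hsimple
      rw [h1, pow_one] at hPR
      set A := Q.eval y / R.eval y with hAdef
      have hR0 : R ≠ 0 := by rintro rfl; simp at hRy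
      obtain ⟨Q₂, hQ₂⟩ : (X - C y) ∣ Q - C A * R := dvd_iff_isRoot.mpr (by
        simp [hAdef, hRy])
      have hQeq : Q = (X - C y) * Q₂ + C A * R := by rw [← hQ₂]; ring
      have hsplit : ∀ z : ℂ, z - y ≠ 0 → aeval z R ≠ 0 →
          aeval z Q / aeval z P = aeval z Q₂ / aeval z R + A / (z - y) := by
        intro z hz hzR
        rw [hPR, hQeq]
        simp only [map_mul, map_add, map_sub, aeval_X, aeval_C, Complex.coe_algebraMap]
        field_simp
      have hdeg : R.natDegree < d := by
        rw [← hd, hPR, natDegree_mul (X_sub_C_ne_zero y) hR0, natDegree_X_sub_C]; omega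
      have hRreal : ∀ z : ℂ, aeval z R = 0 → z.im = 0 := fun z hz => hreal z (by
        rw [hPR]; simp [hz])
      obtain ⟨S, c, L, hS, hf⟩ := ih _ hdeg R Q₂ rfl hR0 hRreal (fun t ht => by
        obtain ⟨B', hB'⟩ := hbd t (by rw [hPR]; simp [ht])
        have hty : (t : ℂ) - y ≠ 0 := by
          intro h
          have : t = y := by exact_mod_cast sub_eq_zero.mp h
          exact hRy (this ▸ ht)
        have hcont : ContinuousAt (fun z : ℂ => ((A : ℂ) / (z - y)).im) t := by
          refine Complex.continuous_im.continuousAt.comp ?_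
          exact ContinuousAt.div (by fun_prop) (by fun_prop) hty
        refine ⟨B' - (((A : ℂ) / ((t : ℂ) - y)).im - 1), ?_⟩
        filter_upwards [hB', hcont.eventually_const_lt (sub_one_lt _)] with z hz hz2 hzi
        have h3 := hz hzi
        rw [hsplit z (fun h => by
            have := congrArg Complex.im h
            simp at this; linarith) (fun h => hzi.ne' (hRreal z h)), Complex.add_im] at h3
        linarith)
      have hyS : y ∉ S := fun h => hRy (hS y h).1
      refine ⟨insert y S, Function.update c y A, L, ?_, fun z hz => ?_⟩
      · intro t ht
        rcases Finset.mem_insert.mp ht with rfl | ht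
        · exact ⟨hy, by simpa using hA.le⟩
        · have hne : t ≠ y := fun h => hyS (h ▸ ht)
          refine ⟨by rw [hPR]; simp [(hS t ht).1], ?_⟩
          rw [Function.update_of_ne hne]
          exact (hS t ht).2
      · have hz' : (z - y) * aeval z R ≠ 0 := by rw [hPR] at hz; simpa using hz
        have hsum : ∑ t ∈ S, (Function.update c y A t : ℂ) / (z - t) =
            ∑ t ∈ S, (c t : ℂ) / (z - t) := by
          refine Finset.sum_congr rfl fun t ht => ?_
          have hne : t ≠ y := fun h => hyS (h ▸ ht)
          rw [Function.update_of_ne hne]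
        rw [hsplit z (left_ne_zero_of_mul hz') (right_ne_zero_of_mul hz'),
          hf z (right_ne_zero_of_mul hz'), Finset.sum_insert hyS, Function.update_self, hsum]
        ring

/-- A real rational function with negative poles that maps the upper half-plane to the closed lower
half-plane and is nonnegative on `[0, ∞)` is a constant plus a nonnegative combination of
the functions `1 / (t - y)` over its poles `y`. -/
theorem exists_stieltjes_form {P Q : ℝ[X]}
    (hreal : ∀ z : ℂ, aeval z P = 0 → z.im = 0)
    (hpos : ∀ t : ℝ, 0 ≤ t → P.eval t ≠ 0)
    (him : ∀ z : ℂ, 0 < z.im → (aeval z Q / aeval z P).im ≤ 0)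
    (hnonneg : ∀ t : ℝ, 0 ≤ t → 0 ≤ Q.eval t / P.eval t) :
    ∃ (S : Finset ℝ) (c : ℝ → ℝ) (b : ℝ),
      (∀ y ∈ S, y < 0 ∧ 0 ≤ c y) ∧
      ∀ t : ℝ, P.eval t ≠ 0 → Q.eval t / P.eval t = b + ∑ y ∈ S, c y * (t - y)⁻¹ := by
  have hP0 : P ≠ 0 := by rintro rfl; simpa using hpos 0 le_rfl
  obtain ⟨S, c, L, hS, hf⟩ := exists_partialFraction_nonneg _ P Q rfl hP0 hreal
    (fun y _ => ⟨0, Eventually.of_forall him⟩)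
  have hS' : ∀ y ∈ S, y < 0 ∧ 0 ≤ c y := fun y hy =>
    ⟨lt_of_not_ge fun h => hpos y h (hS y hy).1, (hS y hy).2⟩
  have haev : ∀ (R : ℝ[X]) (t : ℝ), aeval (t : ℂ) R = ((R.eval t : ℝ) : ℂ) := fun R t =>
    aeval_ofReal (K := ℂ) R t
  have hft : ∀ t : ℝ, P.eval t ≠ 0 →
      Q.eval t / P.eval t = L.eval t + ∑ y ∈ S, c y * (t - y)⁻¹ := by
    intro t ht
    have := hf t (by rw [haev]; exact_mod_cast ht)
    simp only [haev, div_eq_mul_inv] at this ⊢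
    exact_mod_cast this
  suffices hL : L.natDegree = 0 by
    obtain ⟨b, rfl⟩ := natDegree_eq_zero.mp hL
    exact ⟨S, c, b, hS', fun t ht => by simpa using hft t ht⟩
  by_contra hL
  have hLpos : 0 < L.natDegree := Nat.pos_of_ne_zero hL
  have hlead : 0 < L.leadingCoeff := by
    by_contra hneg
    have hbot := tendsto_atBot_of_leadingCoeff_nonpos L
      (natDegree_pos_iff_degree_pos.mp hLpos) (not_lt.mp hneg)
    obtain ⟨t, ht, ht1⟩ := ((hbot.eventually_lt_atBot (-∑ y ∈ S, c y)).and
      (eventually_ge_atTop 1)).exists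
    have h1 := hnonneg t (by linarith)
    rw [hft t (hpos t (by linarith))] at h1
    have h2 : ∑ y ∈ S, c y * (t - y)⁻¹ ≤ ∑ y ∈ S, c y := by
      refine Finset.sum_le_sum fun y hy => mul_le_of_le_one_right (hS' y hy).2 ?_
      exact inv_le_one_of_one_le₀ (by linarith [(hS' y hy).1])
    linarith
  have hcont : ContinuousAt (fun w : ℂ => (∑ y ∈ S, (c y : ℂ) * w / (-1 - y * w)).im) 0 := by
    refine Complex.continuous_im.continuousAt.comp ?_
    refine tendsto_finsetSum _ fun y _ => ?_
    exact ContinuousAt.div (by fun_prop) (by fun_prop) (by simp)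
  have hev := hcont.eventually_const_lt (show (-1 : ℝ) < _ by simp)
  have h := simple_pole_of_im_le (n := L.natDegree) hLpos (y := 0)
    (A := (-1) ^ L.natDegree * L.leadingCoeff) (C := 1)
    (mul_ne_zero (by simp) hlead.ne') (g := fun w => (-1) ^ L.natDegree * aeval (-w) L.reverse)
    (by
      have := Polynomial.continuous_aeval (A := ℂ) L.reverse
      exact Continuous.continuousAt (by fun_prop))
    (by
      simp only [Complex.ofReal_zero, neg_zero]
      rw [← Polynomial.coeff_zero_eq_aeval_zero', coeff_zero_reverse]
      push_cast; rfl)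
    (by
      rw [Complex.ofReal_zero]
      filter_upwards [hev] with w hw hwi
      have hw0 : w ≠ 0 := by rintro rfl; simp at hwi
      have hzi : 0 < (-w⁻¹).im := by
        rw [Complex.neg_im, Complex.inv_im, neg_div, neg_neg]
        exact div_pos hwi (Complex.normSq_pos.mpr hw0)
      have e : (-1) ^ L.natDegree * aeval (-w) L.reverse / (w - 0) ^ L.natDegree
          = aeval (-w⁻¹) L := by
        let _ := invertibleOfNonzero (show -w⁻¹ ≠ 0 by simpa using hw0)
        have := eval₂_reverse_mul_pow (algebraMap ℝ ℂ) (-w⁻¹) L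
        rw [invOf_eq_inv, inv_neg, inv_inv] at this
        rw [aeval_def, aeval_def, ← this, neg_pow w⁻¹, inv_pow, sub_zero]
        ring
      rw [e]
      have h1 := him _ hzi
      rw [hf _ (fun h => hzi.ne' (hreal _ h)), Complex.add_im] at h1
      rw [Finset.sum_congr rfl (g := fun y : ℝ => (c y : ℂ) * w / (-1 - y * w)) (fun y _ => by
        rw [show -w⁻¹ - (y : ℂ) = (-1 - y * w) / w by field_simp, div_div_eq_mul_div])] at h1
      linarith)
  rw [h.1] at h
  linarith [h.2]

end Polynomial

namespace Polynomial

/-- An additive functional that is nonnegative at `1 / (0 - r)` for each root `r` of `q` is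
nonnegative at the logarithmic derivative of `q` at `0`. -/
theorem map_logDeriv_zero_nonneg (φ : ℂ →+ ℝ) {q : ℂ[X]} (hq : q.eval 0 ≠ 0)
    (h : ∀ r, q.eval r = 0 → 0 ≤ φ (1 / (0 - r))) :
    0 ≤ φ (q.derivative.eval 0 / q.eval 0) := by
  rw [(IsAlgClosed.splits q).eval_derivative_div_eval_of_ne_zero hq, map_multiset_sum,
    Multiset.map_map]
  refine Multiset.sum_nonneg fun a ha => ?_
  obtain ⟨r, hr, rfl⟩ := Multiset.mem_map.mp ha
  exact h r (isRoot_of_mem_roots hr)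

/-- A quantitative lower bound off the real axis for a real-rooted polynomial. -/
theorem norm_eval_zero_mul_pow_le {q : ℂ[X]} (hq : ∀ r, q.eval r = 0 → r.im = 0) {N : ℕ}
    (hN : q.natDegree ≤ N) (z : ℂ) :
    ‖q.eval 0‖ * (|z.im| / ‖z‖) ^ N ≤ ‖q.eval z‖ := by
  have hκ0 : 0 ≤ |z.im| / ‖z‖ := by positivity
  have hκ1 : |z.im| / ‖z‖ ≤ 1 := div_le_one_of_le₀ (Complex.abs_im_le_norm z) (norm_nonneg z)
  have hfac : ∀ r : ℂ, r.im = 0 → ‖0 - r‖ * (|z.im| / ‖z‖) ≤ ‖z - r‖ := by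
    intro r hr
    rcases eq_or_ne z 0 with rfl | hz
    · simp
    obtain ⟨a, rfl⟩ : ∃ a : ℝ, (a : ℂ) = r := ⟨r.re, Complex.ext rfl hr.symm⟩
    rw [← mul_div_assoc, div_le_iff₀ (norm_pos_iff.mpr hz)]
    have h := Complex.abs_im_le_norm ((z - a) * (starRingEnd ℂ) z)
    rw [norm_mul, RCLike.norm_conj] at h
    refine le_trans (le_of_eq ?_) h
    rw [zero_sub, norm_neg, Complex.norm_real, Real.norm_eq_abs, ← abs_mul]
    congr 1
    simp only [Complex.mul_im, Complex.sub_re, Complex.sub_im, Complex.conj_re, Complex.conj_im,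
      Complex.ofReal_re, Complex.ofReal_im]
    ring
  have hprod : ∀ M : Multiset ℂ, (∀ r ∈ M, r.im = 0) →
      ‖(M.map fun r => 0 - r).prod‖ * (|z.im| / ‖z‖) ^ Multiset.card M ≤
        ‖(M.map fun r => z - r).prod‖ := by
    intro M
    induction M using Multiset.induction_on with
    | empty => simp
    | cons a M ih =>
      intro hM
      have h1 := hfac a (hM a (Multiset.mem_cons_self a M))
      have h2 := ih fun r hr => hM r (Multiset.mem_cons_of_mem hr)
      simp only [Multiset.map_cons, Multiset.prod_cons, Multiset.card_cons, norm_mul, pow_succ]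
      calc _ = (‖0 - a‖ * (|z.im| / ‖z‖)) *
            (‖(M.map fun r => 0 - r).prod‖ * (|z.im| / ‖z‖) ^ Multiset.card M) := by ring
        _ ≤ _ := by gcongr
  have hs := IsAlgClosed.splits q
  have h := hprod q.roots fun r hr => hq r (isRoot_of_mem_roots hr)
  rw [hs.eval_eq_prod_roots, hs.eval_eq_prod_roots, norm_mul, norm_mul, mul_assoc]
  refine mul_le_mul_of_nonneg_left (le_trans ?_ h) (norm_nonneg _)
  exact mul_le_mul_of_nonneg_left
    (pow_le_pow_of_le_one hκ0 hκ1 ((card_roots' q).trans hN)) (norm_nonneg _)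

end Polynomial

section Line

open Filter Topology

variable {σ R A : Type*} [CommRing R] [CommRing A] [Algebra R A]

/-- The restriction of a multivariate polynomial to the line through `w` with direction `v`. -/
noncomputable def lineRestrict (w v : σ → R) : MvPolynomial σ R →ₐ[R] Polynomial R :=
  MvPolynomial.aeval fun l => Polynomial.C (w l) + Polynomial.C (v l) * Polynomial.X

theorem aeval_lineRestrict (w v : σ → R) (p : MvPolynomial σ R) (z : A) :
    Polynomial.aeval z (lineRestrict w v p) =
      MvPolynomial.aeval (fun l => algebraMap R A (w l) + algebraMap R A (v l) * z) p := by
  have h : (Polynomial.aeval z).comp (lineRestrict w v) =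
      MvPolynomial.aeval (fun l => algebraMap R A (w l) + algebraMap R A (v l) * z) :=
    MvPolynomial.algHom_ext fun l => by simp [lineRestrict]
  exact DFunLike.congr_fun h p

theorem natDegree_lineRestrict_le (w v : σ → R) (p : MvPolynomial σ R) :
    (lineRestrict w v p).natDegree ≤ p.totalDegree := by
  have h := MvPolynomial.aeval_natDegree_le (n := 1) p le_rfl
    (fun l => Polynomial.C (w l) + Polynomial.C (v l) * Polynomial.X)
    (fun l => by
      rw [add_comm]
      exact Polynomial.natDegree_linear_le)
  simpa [lineRestrict] using h

theorem derivative_lineRestrict [DecidableEq σ] (w : σ → R) (i : σ) (p : MvPolynomial σ R) :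
    Polynomial.derivative (lineRestrict w (fun l => if l = i then 1 else 0) p) =
      lineRestrict w (fun l => if l = i then 1 else 0) (pderiv i p) := by
  induction p using MvPolynomial.induction_on with
  | C a => simp [lineRestrict]
  | add p q hp hq => simp [hp, hq]
  | mul_X p n hp =>
    rw [map_mul, Polynomial.derivative_mul, hp, Derivation.leibniz, pderiv_X]
    rcases eq_or_ne n i with rfl | hn
    · simp [lineRestrict]; ring
    · simp [lineRestrict, hn, mul_comm]

theorem continuous_mvPolynomial_aeval (p : MvPolynomial σ ℝ) :
    Continuous fun w : σ → ℂ => MvPolynomial.aeval w p := by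
  simp only [MvPolynomial.aeval_def, ← MvPolynomial.eval_map]
  exact MvPolynomial.continuous_eval _

variable {p : MvPolynomial σ ℝ}

theorem im_eq_zero_of_aeval_lineRestrict_eq_zero
    (hp : ∀ w : σ → ℂ, (∀ l, 0 < (w l).im) → MvPolynomial.aeval w p ≠ 0)
    {x v : σ → ℝ} (hv : ∀ l, 0 < v l) {z : ℂ}
    (hz : Polynomial.aeval z (lineRestrict x v p) = 0) : z.im = 0 := by
  have key : ∀ z : ℂ, Polynomial.aeval z (lineRestrict x v p) = 0 → ¬ 0 < z.im := by
    intro z hz hzi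
    rw [aeval_lineRestrict] at hz
    refine hp _ (fun l => ?_) hz
    simpa using mul_pos (hv l) hzi
  refine le_antisymm (not_lt.mp (key z hz)) ?_
  have h := key ((starRingEnd ℂ) z) (by rw [Polynomial.aeval_conj, hz, map_zero])
  simpa using h

/-- The restriction of a real stable polynomial to a line in a nonnegative direction is real-rooted
as soon as it does not vanish at the base point. -/
theorem im_eq_zero_of_aeval_lineRestrict_eq_zero_of_nonneg
    (hp : ∀ w : σ → ℂ, (∀ l, 0 < (w l).im) → MvPolynomial.aeval w p ≠ 0)
    {x v : σ → ℝ} (hv : ∀ l, 0 ≤ v l)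
    (hx : MvPolynomial.eval x p ≠ 0) {z : ℂ}
    (hz : Polynomial.aeval z (lineRestrict x v p) = 0) : z.im = 0 := by
  by_contra hzi
  have hz0 : z ≠ 0 := by rintro rfl; simp at hzi
  let κ := (|z.im| / ‖z‖) ^ p.totalDegree
  have hκ : 0 < κ := pow_pos (div_pos (abs_pos.mpr hzi) (norm_pos_iff.mpr hz0)) _
  let w : ℝ → σ → ℂ := fun δ l => x l + ((v l + δ : ℝ) : ℂ) * z
  have hw : Continuous w := by
    refine continuous_pi fun l => ?_
    fun_prop
  have hbound : ∀ δ > 0, ‖MvPolynomial.aeval (fun l => (x l : ℂ)) p‖ * κ ≤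
      ‖MvPolynomial.aeval (w δ) p‖ := by
    intro δ hδ
    let q := lineRestrict x (fun l => v l + δ) p
    have hq : ∀ r : ℂ, (q.map (algebraMap ℝ ℂ)).eval r = Polynomial.aeval r q := fun r => by
      rw [Polynomial.eval_map_algebraMap]
    have h := Polynomial.norm_eval_zero_mul_pow_le (q := q.map (algebraMap ℝ ℂ))
      (N := p.totalDegree)
      (fun r hr => im_eq_zero_of_aeval_lineRestrict_eq_zero hp
        (v := fun l => v l + δ) (x := x) (fun l => by linarith [hv l]) (by rwa [hq] at hr))
      (by rw [Polynomial.natDegree_map]; exact natDegree_lineRestrict_le _ _ _) z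
    rw [hq, hq, aeval_lineRestrict, aeval_lineRestrict] at h
    simpa [w, κ] using h
  have hlim : Tendsto (fun δ => ‖MvPolynomial.aeval (w δ) p‖) (𝓝[>] 0)
      (𝓝 ‖MvPolynomial.aeval (w 0) p‖) :=
    (((continuous_mvPolynomial_aeval p).comp hw).norm.tendsto 0).mono_left nhdsWithin_le_nhds
  have hle := ge_of_tendsto hlim (eventually_mem_nhdsWithin.mono fun δ hδ => hbound δ hδ)
  have hw0 : MvPolynomial.aeval (w 0) p = 0 := by
    rw [aeval_lineRestrict] at hz
    simpa [w] using hz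
  have hx' : MvPolynomial.aeval (fun l => (x l : ℂ)) p ≠ 0 := by
    have := MvPolynomial.aeval_algebraMap_apply ℂ x p
    rw [Complex.coe_algebraMap] at this
    simp only [Function.comp_def] at this
    rw [this]
    simpa [MvPolynomial.aeval_eq_eval] using hx
  rw [hw0, norm_zero] at hle
  exact absurd hle (not_le.mpr (mul_pos (norm_pos_iff.mpr hx') hκ))

/-- The logarithmic derivative of a stable polynomial maps `ℍ^σ` to the closed lower half-plane. -/
theorem im_logDeriv_nonpos
    (hp : ∀ w : σ → ℂ, (∀ l, 0 < (w l).im) → MvPolynomial.aeval w p ≠ 0)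
    (i : σ) {w : σ → ℂ} (hw : ∀ l, 0 < (w l).im) :
    (MvPolynomial.aeval w (pderiv i p) / MvPolynomial.aeval w p).im ≤ 0 := by
  classical
  let P := MvPolynomial.map (algebraMap ℝ ℂ) p
  let q := lineRestrict w (fun l => if l = i then 1 else 0) P
  have hq : ∀ r : ℂ, q.eval r =
      MvPolynomial.aeval (fun l => w l + if l = i then r else 0) p := fun r => by
    rw [← Polynomial.coe_aeval_eq_eval, aeval_lineRestrict]
    simp [P, MvPolynomial.aeval_map_algebraMap]
  have hq' : q.derivative.eval 0 = MvPolynomial.aeval w (pderiv i p) := by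
    rw [derivative_lineRestrict, ← Polynomial.coe_aeval_eq_eval, aeval_lineRestrict]
    simp [P, MvPolynomial.pderiv_map, MvPolynomial.aeval_map_algebraMap]
  have hq0 : q.eval 0 = MvPolynomial.aeval w p := by simp [hq]
  have h := Polynomial.map_logDeriv_zero_nonneg (-Complex.imAddGroupHom) (q := q)
    (by rw [hq0]; exact hp w hw) (fun r hr => by
      have hri : r.im ≤ 0 := by
        by_contra hri
        rw [hq] at hr
        refine hp _ (fun l => ?_) hr
        have := hw l
        split_ifs
        · simp; linarith
        · simpa using this
      rw [AddMonoidHom.neg_apply, Complex.coe_imAddGroupHom, one_div, Complex.inv_im,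
        ← neg_div]
      refine div_nonneg ?_ (Complex.normSq_nonneg _)
      simpa using hri)
  rw [hq', hq0] at h
  simpa using h

/-- The logarithmic derivative of a real stable polynomial in direction `i` is nonnegative at a real
point if the polynomial has no zeros on the ray from that point in direction `i`. -/
theorem logDeriv_nonneg [DecidableEq σ]
    (hp : ∀ w : σ → ℂ, (∀ l, 0 < (w l).im) → MvPolynomial.aeval w p ≠ 0)
    (i : σ) {y : σ → ℝ}
    (hy : ∀ s : ℝ, 0 ≤ s → MvPolynomial.eval (fun l => y l + if l = i then s else 0) p ≠ 0) :
    0 ≤ MvPolynomial.eval y (pderiv i p) / MvPolynomial.eval y p := by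
  let q := lineRestrict y (fun l => if l = i then 1 else 0) p
  have hq : ∀ s : ℝ, q.eval s = MvPolynomial.eval (fun l => y l + if l = i then s else 0) p :=
    fun s => by
      rw [← Polynomial.coe_aeval_eq_eval, aeval_lineRestrict]
      simp [MvPolynomial.aeval_eq_eval]
  have hq' : q.derivative.eval 0 = MvPolynomial.eval y (pderiv i p) := by
    rw [derivative_lineRestrict, ← Polynomial.coe_aeval_eq_eval, aeval_lineRestrict]
    simp [MvPolynomial.aeval_eq_eval]
  have hq0 : q.eval 0 = MvPolynomial.eval y p := by simp [hq]
  have hne : MvPolynomial.eval y p ≠ 0 := by simpa using hy 0 le_rfl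
  have hcast : ∀ (f : Polynomial ℝ) (s : ℝ),
      (f.map (algebraMap ℝ ℂ)).eval (s : ℂ) = ((f.eval s : ℝ) : ℂ) := fun f s => by
    rw [Polynomial.eval_map_algebraMap]
    exact Polynomial.aeval_ofReal (K := ℂ) f s
  have h := Polynomial.map_logDeriv_zero_nonneg Complex.reAddGroupHom
    (q := q.map (algebraMap ℝ ℂ))
    (by
      rw [← Complex.ofReal_zero, hcast, hq0]
      exact_mod_cast hne)
    (fun r hr => by
      have hri : r.im = 0 := im_eq_zero_of_aeval_lineRestrict_eq_zero_of_nonneg hp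
        (v := fun l => if l = i then 1 else 0) (fun l => by split_ifs <;> simp) hne
        (by rwa [Polynomial.eval_map_algebraMap] at hr)
      obtain ⟨s, rfl⟩ : ∃ s : ℝ, (s : ℂ) = r := ⟨r.re, Complex.ext rfl hri.symm⟩
      rw [hcast, hq] at hr
      have hs : s < 0 := lt_of_not_ge fun h => hy s h (by exact_mod_cast hr)
      have : (1 / (0 - (s : ℂ))) = ((1 / (0 - s) : ℝ) : ℂ) := by push_cast; rfl
      rw [this, Complex.coe_reAddGroupHom, Complex.ofReal_re]
      exact one_div_nonneg.mpr (by linarith))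
  rw [Polynomial.derivative_map, ← Complex.ofReal_zero, hcast, hcast, hq', hq0,
    ← Complex.ofReal_div, Complex.coe_reAddGroupHom, Complex.ofReal_re] at h
  exact h

/-- In a coordinate direction `j`, the logarithmic derivative of a real stable polynomial without
zeros in the orthant above `x` is a nonnegative combination of simple poles on the negative
half-line plus a constant. -/
theorem logDeriv_stieltjes_form [DecidableEq σ]
    (hp : ∀ w : σ → ℂ, (∀ l, 0 < (w l).im) → MvPolynomial.aeval w p ≠ 0)
    (i j : σ) {x : σ → ℝ}
    (hx : ∀ y : σ → ℝ, x ≤ y → MvPolynomial.eval y p ≠ 0) :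
    ∃ (S : Finset ℝ) (c : ℝ → ℝ) (b : ℝ), (∀ y ∈ S, y < 0 ∧ 0 ≤ c y) ∧
      ∀ t : ℝ, MvPolynomial.eval (fun l => x l + if l = j then t else 0) p ≠ 0 →
        MvPolynomial.eval (fun l => x l + if l = j then t else 0) (pderiv i p) /
          MvPolynomial.eval (fun l => x l + if l = j then t else 0) p =
            b + ∑ y ∈ S, c y * (t - y)⁻¹ := by
  let e : σ → ℝ := fun l => if l = j then 1 else 0
  have he : ∀ l, 0 ≤ e l := fun l => by simp only [e]; split_ifs <;> simp
  have hev : ∀ (f : MvPolynomial σ ℝ) (t : ℝ), (lineRestrict x e f).eval t =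
      MvPolynomial.eval (fun l => x l + if l = j then t else 0) f := fun f t => by
    rw [← Polynomial.coe_aeval_eq_eval, aeval_lineRestrict]
    simp [MvPolynomial.aeval_eq_eval, e]
  have hle : ∀ t : ℝ, 0 ≤ t → x ≤ fun l => x l + if l = j then t else 0 := fun t ht l => by
    simp only; split_ifs <;> linarith
  have hreal : ∀ z : ℂ, Polynomial.aeval z (lineRestrict x e p) = 0 → z.im = 0 := fun z hz =>
    im_eq_zero_of_aeval_lineRestrict_eq_zero_of_nonneg hp he (hx x le_rfl) hz
  have him : ∀ z : ℂ, 0 < z.im → (Polynomial.aeval z (lineRestrict x e (pderiv i p)) /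
      Polynomial.aeval z (lineRestrict x e p)).im ≤ 0 := by
    intro z hz
    have hne : Polynomial.aeval z (lineRestrict x e p) ≠ 0 := fun h => hz.ne' (hreal z h)
    simp only [aeval_lineRestrict] at hne ⊢
    let w : ℝ → σ → ℂ := fun ε l => x l + e l * z + ε * Complex.I
    have hw : Continuous w := by
      refine continuous_pi fun l => ?_
      fun_prop
    have hw0 : w 0 = fun l => algebraMap ℝ ℂ (x l) + algebraMap ℝ ℂ (e l) * z := by
      funext l; simp [w]
    rw [← hw0] at hne ⊢
    have hcont : ContinuousAt (fun ε => (MvPolynomial.aeval (w ε) (pderiv i p) /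
        MvPolynomial.aeval (w ε) p).im) 0 := by
      refine Complex.continuous_im.continuousAt.comp (ContinuousAt.div ?_ ?_ hne)
      · exact ((continuous_mvPolynomial_aeval _).comp hw).continuousAt
      · exact ((continuous_mvPolynomial_aeval _).comp hw).continuousAt
    refine le_of_tendsto (hcont.tendsto.mono_left (nhdsWithin_le_nhds (s := Set.Ioi 0)))
      (eventually_mem_nhdsWithin.mono fun ε hε => im_logDeriv_nonpos hp i fun l => ?_)
    have h1 : 0 ≤ e l * z.im := mul_nonneg (he l) hz.le
    have h2 : 0 < ε := hε
    simp only [w, Complex.add_im, Complex.ofReal_im, Complex.im_ofReal_mul, Complex.I_im]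
    linarith
  obtain ⟨S, c, b, hS, hf⟩ := Polynomial.exists_stieltjes_form hreal
    (fun t ht => by rw [hev]; exact hx _ (hle t ht)) him
    (fun t ht => by
      rw [hev, hev]
      refine logDeriv_nonneg hp i fun s hs => hx _ ?_
      refine (hle t ht).trans fun l => ?_
      simp only; split_ifs <;> linarith)
  refine ⟨S, c, b, hS, fun t ht => ?_⟩
  have := hf t (by rwa [hev])
  rwa [hev, hev] at this

end Line

section Stieltjes

variable {S : Finset ℝ} {c : ℝ → ℝ} {b : ℝ}

theorem iteratedDeriv_stieltjes_alternating (hS : ∀ y ∈ S, y < 0 ∧ 0 ≤ c y)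
    {k : ℕ} (hk : 0 < k) :
    0 ≤ (-1 : ℝ) ^ k * iteratedDeriv k (fun t : ℝ => b + ∑ y ∈ S, c y * (t - y)⁻¹) 0 := by
  have hcd : ∀ y ∈ S, ContDiffAt ℝ k (fun t : ℝ => c y * (t - y)⁻¹) 0 := by
    intro y hy
    have : (0 : ℝ) - y ≠ 0 := by linarith [(hS y hy).1]
    exact contDiffAt_const.mul ((contDiffAt_id.sub contDiffAt_const).inv this)
  rw [iteratedDeriv_const_add hk, iteratedDeriv_fun_sum hcd, Finset.mul_sum]
  refine Finset.sum_nonneg fun y hy => ?_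
  obtain ⟨hy0, hc⟩ := hS y hy
  rw [iteratedDeriv_const_mul_field, iteratedDeriv_comp_sub_const k (fun t : ℝ => t⁻¹) y,
    iteratedDeriv_eq_iterate]
  have h' : deriv^[k] (fun t : ℝ => t⁻¹) (0 - y) = _ := iter_deriv_inv k (0 - y)
  beta_reduce
  rw [h']
  have hpos : 0 < 0 - y := by linarith
  have hsq : (-1 : ℝ) ^ k * (-1) ^ k = 1 := by rw [← mul_pow]; simp
  calc (0 : ℝ) ≤ c y * (k.factorial * (0 - y) ^ (-1 - k : ℤ)) := by positivity
    _ = ((-1 : ℝ) ^ k * (-1) ^ k) * (c y * (k.factorial * (0 - y) ^ (-1 - k : ℤ))) := by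
      rw [hsq, one_mul]
    _ = _ := by ring

theorem antitoneOn_stieltjes (hS : ∀ y ∈ S, y < 0 ∧ 0 ≤ c y) :
    AntitoneOn (fun t : ℝ => b + ∑ y ∈ S, c y * (t - y)⁻¹) (Set.Ici 0) := by
  intro s hs t _ hst
  have hs : 0 ≤ s := hs
  refine add_le_add_right (Finset.sum_le_sum fun y hy => ?_) b
  obtain ⟨hy0, hc⟩ := hS y hy
  exact mul_le_mul_of_nonneg_left (inv_anti₀ (by linarith) (by linarith)) hc

theorem convexOn_stieltjes (hS : ∀ y ∈ S, y < 0 ∧ 0 ≤ c y) :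
    ConvexOn ℝ (Set.Ici 0) (fun t : ℝ => b + ∑ y ∈ S, c y * (t - y)⁻¹) := by
  refine (convexOn_const b (convex_Ici 0)).add ?_
  refine ⟨convex_Ici 0, fun s hs t ht α β hα hβ hαβ => ?_⟩
  have hs : 0 ≤ s := hs
  have ht : 0 ≤ t := ht
  simp only [smul_eq_mul, Finset.mul_sum, ← Finset.sum_add_distrib]
  refine Finset.sum_le_sum fun y hy => ?_
  obtain ⟨hy0, hc⟩ := hS y hy
  have h := (convexOn_zpow (𝕜 := ℝ) (-1)).2 (show 0 < s - y by linarith)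
    (show 0 < t - y by linarith) hα hβ hαβ
  simp only [smul_eq_mul, zpow_neg_one] at h
  have e : α * s + β * t - y = α * (s - y) + β * (t - y) := by
    linear_combination y * hαβ
  rw [e]
  calc _ ≤ c y * (α * (s - y)⁻¹ + β * (t - y)⁻¹) := mul_le_mul_of_nonneg_left h hc
    _ = _ := by ring

end Stieltjes

/-- If `p` is real stable and has no zeros in `{y : y ≥ x}`, then
`(-1)^k (∂_j)^k Φ_p^i(x') ≥ 0` for all `k ≥ 0`, all directions `i, j`, and all
`x' ≥ x`; in particular `t ↦ Φ_p^i(x + t e_j)` is nonnegative, nonincreasing and convex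
on `[0, ∞)`. -/
theorem barrier_deriv_alternating (m : ℕ) (p : MvPolynomial (Fin m) ℂ)
    (hp : RealStable p) (x : Fin m → ℝ)
    (hx : ∀ y : Fin m → ℝ, x ≤ y → MvPolynomial.eval (fun l => ((y l : ℂ))) p ≠ 0) :
    (∀ (k : ℕ) (i j : Fin m) (x' : Fin m → ℝ), x ≤ x' →
      0 ≤ (-1 : ℝ) ^ k *
        iteratedDeriv k
          (fun s : ℝ => barrier p i (fun l => x' l + if l = j then s else 0)) 0) ∧
    (∀ (i j : Fin m),
      (∀ t : ℝ, 0 ≤ t →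
        0 ≤ barrier p i (fun l => x l + if l = j then t else 0)) ∧
      AntitoneOn (fun t : ℝ => barrier p i (fun l => x l + if l = j then t else 0))
        (Set.Ici 0) ∧
      ConvexOn ℝ (Set.Ici 0)
        (fun t : ℝ => barrier p i (fun l => x l + if l = j then t else 0))) := by
  obtain ⟨q, rfl⟩ : ∃ q : MvPolynomial (Fin m) ℝ, MvPolynomial.map (algebraMap ℝ ℂ) q = p := by
    refine MvPolynomial.mem_range_map_iff_coeffs_subset.mpr fun a ha => ?_
    obtain ⟨d, -, rfl⟩ := MvPolynomial.mem_coeffs_iff.mp ha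
    obtain ⟨r, hr⟩ := hp.1 d
    exact ⟨r, hr.symm⟩
  have hq : ∀ w : Fin m → ℂ, (∀ l, 0 < (w l).im) → MvPolynomial.aeval w q ≠ 0 := fun w hw => by
    have h := hp.2 w hw
    rwa [MvPolynomial.eval_map, ← MvPolynomial.aeval_def] at h
  have hcast : ∀ (f : MvPolynomial (Fin m) ℝ) (y : Fin m → ℝ),
      MvPolynomial.eval (fun l => (y l : ℂ)) (MvPolynomial.map (algebraMap ℝ ℂ) f) =
        ((MvPolynomial.eval y f : ℝ) : ℂ) := fun f y => by
    rw [MvPolynomial.eval_map]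
    exact MvPolynomial.eval₂_comp (algebraMap ℝ ℂ) y f |>.symm
  have hbar : ∀ (i : Fin m) (y : Fin m → ℝ),
      barrier (MvPolynomial.map (algebraMap ℝ ℂ) q) i y =
        MvPolynomial.eval y (pderiv i q) / MvPolynomial.eval y q := fun i y => by
    rw [barrier, MvPolynomial.pderiv_map, hcast, hcast, ← Complex.ofReal_div, Complex.ofReal_re]
  have hx' : ∀ y : Fin m → ℝ, x ≤ y → MvPolynomial.eval y q ≠ 0 := fun y hy h =>
    hx y hy (by rw [hcast, h, Complex.ofReal_zero])
  have hshift : ∀ (y : Fin m → ℝ) (j : Fin m) (t : ℝ), x ≤ y → 0 ≤ t →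
      x ≤ fun l => y l + if l = j then t else 0 := fun y j t hy ht l => by
    have := hy l
    simp only
    split_ifs <;> linarith
  have hnonneg : ∀ (i : Fin m) (y : Fin m → ℝ), x ≤ y →
      0 ≤ barrier (MvPolynomial.map (algebraMap ℝ ℂ) q) i y := fun i y hy => by
    rw [hbar]
    exact logDeriv_nonneg hq i fun s hs => hx' _ (hshift y i s hy hs)
  constructor
  · intro k i j x' hxx'
    rcases Nat.eq_zero_or_pos k with rfl | hk
    · simpa using hnonneg i x' hxx'
    obtain ⟨S, c, b, hS, hf⟩ := logDeriv_stieltjes_form hq i j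
      (x := x') fun y hy => hx' y (hxx'.trans hy)
    have hev : (fun s : ℝ => barrier (MvPolynomial.map (algebraMap ℝ ℂ) q) i
        (fun l => x' l + if l = j then s else 0)) =ᶠ[nhds 0]
          fun t => b + ∑ y ∈ S, c y * (t - y)⁻¹ := by
      have hcont : Continuous fun s : ℝ =>
          MvPolynomial.eval (fun l => x' l + if l = j then s else 0) q := by
        refine (MvPolynomial.continuous_eval q).comp (continuous_pi fun l => ?_)
        split_ifs <;> fun_prop
      filter_upwards [hcont.continuousAt.eventually_ne (hx' _ (hshift x' j 0 hxx' le_rfl))]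
        with s hs
      rw [hbar, hf s hs]
    rw [hev.iteratedDeriv_eq]
    exact iteratedDeriv_stieltjes_alternating hS hk
  · intro i j
    obtain ⟨S, c, b, hS, hf⟩ := logDeriv_stieltjes_form hq i j hx'
    have heq : Set.EqOn (fun t : ℝ => b + ∑ y ∈ S, c y * (t - y)⁻¹)
        (fun t : ℝ => barrier (MvPolynomial.map (algebraMap ℝ ℂ) q) i
          (fun l => x l + if l = j then t else 0)) (Set.Ici 0) := fun t ht => by
      simp only [hbar]
      exact (hf t (hx' _ (hshift x j t le_rfl ht))).symm
    exact ⟨fun t ht => hnonneg i _ (hshift x j t le_rfl ht),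
      (antitoneOn_stieltjes hS).congr heq, (convexOn_stieltjes hS).congr heq⟩
end

section
/- Let p(z_1, ..., z_m) be a real stable polynomial and x ∈ ℝ^m such that p has no zeros in the set {y ∈ ℝ^m : y ≥ x}. Then for every y ∈ ℝ^m with y ≥ x and every j = 1, ..., m, one has Φ_p^j(y) ≤ Φ_p^j(x). -/
open MvPolynomial

/-- Restricting all variables but the `j`-th to constants commutes with differentiating in the
`j`-th variable. -/
theorem derivative_aeval_update {R σ : Type*} [CommSemiring R] [DecidableEq σ]
    (p : MvPolynomial σ R) (z : σ → R) (j : σ) :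
    (aeval (Function.update (fun l => Polynomial.C (z l)) j Polynomial.X) p).derivative =
      aeval (Function.update (fun l => Polynomial.C (z l)) j Polynomial.X) (pderiv j p) := by
  induction p using MvPolynomial.induction_on with
  | C a => simp [Polynomial.algebraMap_eq]
  | add p q hp hq => simp [hp, hq]
  | mul_X p i hp =>
    rcases eq_or_ne i j with rfl | h
    · simp [hp, mul_comm]
    · simp [hp, pderiv_X_of_ne h, h, mul_comm]

theorem eval_aeval_update {R σ : Type*} [CommSemiring R] [DecidableEq σ]
    (p : MvPolynomial σ R) (z : σ → R) (j : σ) (c : R) :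
    (aeval (Function.update (fun l => Polynomial.C (z l)) j Polynomial.X) p).eval c =
      eval (Function.update z j c) p := by
  induction p using MvPolynomial.induction_on with
  | C a => simp [Polynomial.algebraMap_eq]
  | add p q hp hq => simp [hp, hq]
  | mul_X p i hp =>
    rcases eq_or_ne i j with rfl | h
    · simp [hp]
    · simp [hp, h]

/-- The logarithmic derivative of a complex polynomial has nonpositive imaginary part at every
point lying above all the roots. -/
theorem Polynomial.im_derivative_div_nonpos (P : Polynomial ℂ) (c : ℂ) (hc : P.eval c ≠ 0)
    (hP : ∀ r, P.eval r = 0 → r.im ≤ c.im) :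
    (P.derivative.eval c / P.eval c).im ≤ 0 := by
  rw [(IsAlgClosed.splits P).eval_derivative_div_eval_of_ne_zero hc, ← Complex.coe_imAddGroupHom,
    map_multiset_sum, Multiset.map_map, ← neg_nonneg, ← Multiset.sum_map_neg']
  refine Multiset.sum_nonneg fun a ha => ?_
  obtain ⟨b, hb, rfl⟩ := Multiset.mem_map.1 ha
  obtain ⟨r, hr, rfl⟩ := Multiset.mem_map.1 hb
  have hr' := hP r (Polynomial.isRoot_of_mem_roots hr)
  simp only [Function.comp_apply, Complex.coe_imAddGroupHom, one_div, Complex.inv_im,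
    Complex.sub_im]
  rw [← neg_div, neg_neg]
  exact div_nonneg (sub_nonneg.2 hr') (Complex.normSq_nonneg _)

theorem RealStable.im_pderiv_div_nonpos {m : ℕ} {p : MvPolynomial (Fin m) ℂ} (hp : RealStable p)
    {z : Fin m → ℂ} (hz : ∀ i, 0 < (z i).im) (j : Fin m) :
    (eval z (pderiv j p) / eval z p).im ≤ 0 := by
  have key := Polynomial.im_derivative_div_nonpos
    (aeval (Function.update (fun l => Polynomial.C (z l)) j Polynomial.X) p) (z j)
  rw [derivative_aeval_update] at key
  simp only [eval_aeval_update, Function.update_eq_self] at key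
  refine key (hp.2 z hz) fun r hr => ?_
  by_contra! h
  refine hp.2 _ (fun i => ?_) hr
  rcases eq_or_ne i j with rfl | hi
  · simpa using (hz i).trans h
  · simpa [hi] using hz i

theorem RealStable.exists_map_eq {m : ℕ} {p : MvPolynomial (Fin m) ℂ} (hp : RealStable p) :
    ∃ q : MvPolynomial (Fin m) ℝ, map Complex.ofRealHom q = p := by
  refine mem_range_map_iff_coeffs_subset.2 fun a ha => ?_
  obtain ⟨c, -, rfl⟩ := mem_coeffs_iff.1 ha
  obtain ⟨r, hr⟩ := hp.1 c
  exact ⟨r, hr.symm⟩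

theorem eval_ofReal_map {σ : Type*} (q : MvPolynomial σ ℝ) (y : σ → ℝ) :
    eval (fun l => (y l : ℂ)) (map Complex.ofRealHom q) = (eval y q : ℂ) := by
  rw [eval_map]
  exact (eval₂_comp_left Complex.ofRealHom (RingHom.id ℝ) y q).symm

theorem RealStable.im_pderiv_div_ofReal {m : ℕ} {p : MvPolynomial (Fin m) ℂ} (hp : RealStable p)
    (y : Fin m → ℝ) (j : Fin m) :
    (eval (fun l => (y l : ℂ)) (pderiv j p) / eval (fun l => (y l : ℂ)) p).im = 0 := by
  obtain ⟨q, rfl⟩ := hp.exists_map_eq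
  rw [pderiv_map, eval_ofReal_map, eval_ofReal_map, ← Complex.ofReal_div, Complex.ofReal_im]

theorem differentiable_eval_line {σ : Type*} (p : MvPolynomial σ ℂ) (x v : σ → ℂ) :
    Differentiable ℂ fun t : ℂ => eval (fun l => x l + t * v l) p := by
  induction p using MvPolynomial.induction_on with
  | C a => simp
  | add p q hp hq => simpa using hp.fun_add hq
  | mul_X p i hp => simpa using hp.fun_mul (by fun_prop)

/-- A function differentiable at a real point, real there, and with nonpositive imaginary part
directly above it, has a derivative with nonpositive real part. -/
theorem HasDerivAt.re_nonpos_of_im_nonpos {G : ℂ → ℂ} {G' : ℂ} {t : ℝ} (hG : HasDerivAt G G' t)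
    (h₀ : (G t).im = 0) (hpos : ∀ s : ℝ, 0 < s → (G (t + s * Complex.I)).im ≤ 0) :
    G'.re ≤ 0 := by
  have hG₀ : HasDerivAt G G' ((t : ℂ) + ((0 : ℝ) : ℂ) * Complex.I) := by simpa using hG
  have hline : HasDerivAt (fun s : ℂ => (t : ℂ) + s * Complex.I) Complex.I ((0 : ℝ) : ℂ) := by
    simpa using ((hasDerivAt_id ((0 : ℝ) : ℂ)).mul_const Complex.I).const_add (t : ℂ)
  have hcomp := ((hG₀.comp ((0 : ℝ) : ℂ) hline).const_mul (-Complex.I)).real_of_complex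
  have hlim := hcomp.tendsto_slope_zero_right
  have hval : (-Complex.I * (G' * Complex.I)).re = G'.re := by simp
  rw [hval] at hlim
  refine le_of_tendsto hlim ?_
  filter_upwards [self_mem_nhdsWithin] with s hs
  have hs' : 0 < s := hs
  simpa [h₀] using mul_nonpos_of_nonneg_of_nonpos (inv_nonneg.2 hs'.le) (hpos s hs')

theorem RealStable.barrier_add_le {m : ℕ} {p : MvPolynomial (Fin m) ℂ} (hp : RealStable p)
    {x v : Fin m → ℝ} (hv : ∀ i, 0 < v i)
    (hx : ∀ y : Fin m → ℝ, x ≤ y → eval (fun l => (y l : ℂ)) p ≠ 0) (j : Fin m) :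
    barrier p j (x + v) ≤ barrier p j x := by
  set G : ℂ → ℂ := fun t => eval (fun l => (x l : ℂ) + t * v l) (pderiv j p) /
    eval (fun l => (x l : ℂ) + t * v l) p with hG
  have hreal (t : ℝ) : (fun l => (x l : ℂ) + t * v l) = fun l => ((x l + t * v l : ℝ) : ℂ) := by
    ext l; push_cast; rfl
  have hd (t : ℝ) (ht : 0 ≤ t) : HasDerivAt G (deriv G t) t := by
    refine DifferentiableAt.hasDerivAt ?_
    refine (differentiable_eval_line _ _ _ _).div (differentiable_eval_line _ _ _ _) ?_
    rw [hreal]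
    exact hx _ fun l => le_add_of_nonneg_right (mul_nonneg ht (hv l).le)
  have hneg (t : ℝ) (ht : 0 ≤ t) : (deriv G t).re ≤ 0 := by
    refine (hd t ht).re_nonpos_of_im_nonpos ?_ fun s hs => hp.im_pderiv_div_nonpos (fun i => ?_) j
    · simp only [hG]
      rw [hreal]
      exact hp.im_pderiv_div_ofReal _ j
    · simpa using mul_pos hs (hv i)
  have hanti : AntitoneOn (fun t : ℝ => (G t).re) (Set.Ici 0) := by
    refine antitoneOn_of_deriv_nonpos (convex_Ici 0)
      (fun t ht => (hd t ht).real_of_complex.continuousAt.continuousWithinAt)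
      (fun t ht => ?_) fun t ht => ?_
    · exact (hd t (interior_subset ht)).real_of_complex.differentiableAt.differentiableWithinAt
    · rw [(hd t (interior_subset ht)).real_of_complex.deriv]
      exact hneg t (interior_subset ht)
  simpa [hG, barrier] using hanti (Set.self_mem_Ici) (Set.mem_Ici.2 zero_le_one) zero_le_one

theorem continuousAt_barrier {m : ℕ} {p : MvPolynomial (Fin m) ℂ} {y : Fin m → ℝ}
    (hy : eval (fun l => (y l : ℂ)) p ≠ 0) (j : Fin m) : ContinuousAt (barrier p j) y := by
  have hcoe : Continuous fun (w : Fin m → ℝ) (l : Fin m) => (w l : ℂ) := by fun_prop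
  exact Complex.continuous_re.continuousAt.comp
    (((pderiv j p).continuous_eval.comp hcoe).continuousAt.div
      (p.continuous_eval.comp hcoe).continuousAt hy)

/-- If the real stable polynomial `p` has no zeros in `{y : y ≥ x}`, then for every
`y ≥ x` and every direction `j`, `Φ_p^j(y) ≤ Φ_p^j(x)`. -/
theorem barrier_mono (m : ℕ) (p : MvPolynomial (Fin m) ℂ)
    (hp : RealStable p) (x : Fin m → ℝ)
    (hx : ∀ y : Fin m → ℝ, x ≤ y → MvPolynomial.eval (fun l => ((y l : ℂ))) p ≠ 0) :
    ∀ y : Fin m → ℝ, x ≤ y → ∀ j : Fin m, barrier p j y ≤ barrier p j x := by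
  intro y hxy j
  have hshift : Continuous fun δ : ℝ => y + fun _ : Fin m => δ := by fun_prop
  have hy : (y + fun _ : Fin m => (0 : ℝ)) = y := add_zero y
  have hlim : Filter.Tendsto (fun δ : ℝ => barrier p j (y + fun _ => δ))
      (nhdsWithin 0 (Set.Ioi 0)) (nhds (barrier p j y)) := by
    refine (continuousAt_barrier (hx y hxy) j).tendsto.comp ?_
    simpa only [hy] using (hshift.tendsto 0).mono_left nhdsWithin_le_nhds
  refine le_of_tendsto hlim ?_
  filter_upwards [self_mem_nhdsWithin] with δ hδ
  have hδ' : 0 < δ := hδ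
  have hle := hp.barrier_add_le (v := (y + fun _ => δ) - x)
    (fun i => by simpa using (hxy i).trans_lt (lt_add_of_pos_right _ hδ')) hx j
  rwa [add_sub_cancel] at hle
end

section
/- Let p(z_1, ..., z_m) be a real stable polynomial and x ∈ ℝ^m such that p has no zeros in {y ∈ ℝ^m : y ≥ x}. Suppose there exists δ > 0 such that Φ_p^j(x) + 1/δ ≤ 1 for every j = 1, ..., m. Then the polynomial (∏_{i=1}^m (1 - ∂_i)) p has no zeros in the set {y ∈ ℝ^m : y ≥ x + (δ, δ, ..., δ)}. -/
open MvPolynomial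

/-- The operator `∏_{i=1}^m (1 - ∂_i)` applied to `p` (the operators `1 - ∂_i`
commute, so the order of application is irrelevant). -/
noncomputable def oneSubPderivProd {m : ℕ} (p : MvPolynomial (Fin m) ℂ) :
    MvPolynomial (Fin m) ℂ :=
  (List.finRange m).foldr (fun i q => q - MvPolynomial.pderiv i q) p


section Univariate

open Polynomial Filter Topology ComplexConjugate

theorem Complex.eq_one_and_pos_of_im_mul_im_mul_pow_nonneg {c : ℂ} (hc : c ≠ 0) {k : ℕ}
    (hk : 1 ≤ k) (h : ∀ w : ℂ, 0 ≤ w.im * (c * w ^ k).im) :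
    k = 1 ∧ c.im = 0 ∧ 0 < c.re := by
  have hk0 : (0 : ℝ) < k := by exact_mod_cast hk
  have harg : ∀ θ : ℝ, 0 ≤ Real.sin θ * (c.re * Real.sin (k * θ) + c.im * Real.cos (k * θ)) := by
    intro θ
    have := h (Complex.exp (θ * Complex.I))
    rw [← Complex.exp_nat_mul, show (k : ℂ) * (θ * Complex.I) = ((k * θ : ℝ) : ℂ) * Complex.I by
      push_cast; ring] at this
    rw [Complex.mul_im, Complex.exp_ofReal_mul_I_re, Complex.exp_ofReal_mul_I_im,
      Complex.exp_ofReal_mul_I_im] at this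
    exact this
  have him : c.im = 0 := by
    have hpos : ∀ᶠ θ in 𝓝[>] (0 : ℝ), θ < Real.pi :=
      (eventually_lt_nhds Real.pi_pos).filter_mono nhdsWithin_le_nhds
    have hlim : Tendsto (fun θ : ℝ => c.re * Real.sin (k * θ) + c.im * Real.cos (k * θ))
        (𝓝[>] 0) (𝓝 c.im) := by
      have : Continuous (fun θ : ℝ => c.re * Real.sin (k * θ) + c.im * Real.cos (k * θ)) := by
        fun_prop
      simpa using (this.tendsto 0).mono_left nhdsWithin_le_nhds
    have hlim' : Tendsto (fun θ : ℝ => c.re * Real.sin (k * -θ) + c.im * Real.cos (k * -θ))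
        (𝓝[>] 0) (𝓝 c.im) := by
      have : Continuous (fun θ : ℝ => c.re * Real.sin (k * -θ) + c.im * Real.cos (k * -θ)) := by
        fun_prop
      simpa using (this.tendsto 0).mono_left nhdsWithin_le_nhds
    refine le_antisymm (le_of_tendsto hlim' ?_) (ge_of_tendsto hlim ?_)
    · filter_upwards [hpos, self_mem_nhdsWithin] with θ h1 h2
      have hs := Real.sin_pos_of_pos_of_lt_pi h2 h1
      have := harg (-θ)
      rw [Real.sin_neg] at this
      nlinarith
    · filter_upwards [hpos, self_mem_nhdsWithin] with θ h1 h2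
      exact nonneg_of_mul_nonneg_right (harg θ) (Real.sin_pos_of_pos_of_lt_pi h2 h1)
  have hre : c.re ≠ 0 := fun h0 => hc (Complex.ext h0 him)
  have hsin : ∀ a : ℝ, 0 < a → a < k → 0 ≤ c.re * Real.sin (a * Real.pi) := by
    intro a ha hak
    have := harg (a * Real.pi / k)
    rw [him, mul_div_cancel₀ _ hk0.ne', zero_mul, add_zero] at this
    refine nonneg_of_mul_nonneg_right this (Real.sin_pos_of_pos_of_lt_pi ?_ ?_)
    · have := Real.pi_pos
      positivity
    · rw [div_lt_iff₀ hk0]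
      nlinarith [Real.pi_pos]
  have hrepos : 0 < c.re := by
    have hk1 : (1 : ℝ) ≤ k := by exact_mod_cast hk
    have := hsin (1 / 2) (by norm_num) (by linarith)
    rw [show (1 / 2 : ℝ) * Real.pi = Real.pi / 2 by ring, Real.sin_pi_div_two] at this
    exact lt_of_le_of_ne (by linarith) hre.symm
  refine ⟨?_, him, hrepos⟩
  by_contra hne
  have hk2 : (2 : ℝ) ≤ k := by exact_mod_cast (by omega : 2 ≤ k)
  have := hsin (3 / 2) (by norm_num) (by linarith)
  rw [show (3 / 2 : ℝ) * Real.pi = Real.pi / 2 + Real.pi by ring, Real.sin_add_pi,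
    Real.sin_pi_div_two] at this
  linarith

/-- A polynomial whose imaginary part is almost nonpositive in the upper half-plane and almost
nonnegative in the lower one is affine with nonpositive real slope. -/
theorem Polynomial.exists_affine_of_im_mul_im_le {Q : ℂ[X]} {K : ℝ}
    (h : ∀ z : ℂ, z.im ≠ 0 → z.im * (Q.eval z).im ≤ K) :
    ∃ (d : ℂ) (c : ℝ), 0 ≤ c ∧ ∀ z, Q.eval z = d - c * z := by
  by_cases hn : Q.natDegree = 0
  · refine ⟨Q.coeff 0, 0, le_rfl, fun z => ?_⟩
    conv_lhs => rw [Polynomial.eq_C_of_natDegree_eq_zero hn]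
    simp
  have hlead : -Q.leadingCoeff ≠ 0 := by
    rw [neg_ne_zero, Polynomial.leadingCoeff_ne_zero]
    rintro rfl
    simp at hn
  obtain ⟨h1, him, hre⟩ := Complex.eq_one_and_pos_of_im_mul_im_mul_pow_nonneg hlead
    (Nat.one_le_iff_ne_zero.2 hn) (by
      intro w
      rcases eq_or_ne w.im 0 with hw | hw
      · simp [hw]
      have hw0 : w ≠ 0 := by
        rintro rfl
        simp at hw
      have hlim : Tendsto (fun τ : ℝ => Q.eval (τ * w) / (τ : ℂ) ^ Q.natDegree) atTop
          (𝓝 (Q.leadingCoeff * w ^ Q.natDegree)) := by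
        have hc : Tendsto (fun τ : ℝ => (τ : ℂ) * w) atTop (Bornology.cobounded ℂ) := by
          rw [← tendsto_norm_atTop_iff_cobounded]
          simp only [norm_mul, Complex.norm_real]
          exact (tendsto_abs_atTop_atTop).atTop_mul_const (norm_pos_iff.2 hw0)
        have he := (Polynomial.isEquivalent_cobounded_leading_monomial (P := Q)).comp_tendsto hc
        have he' := he.div (Asymptotics.IsEquivalent.refl
          (u := fun τ : ℝ => (τ : ℂ) ^ Q.natDegree))
        refine he'.symm.tendsto_nhds ?_
        refine tendsto_const_nhds.congr' ?_
        filter_upwards [eventually_gt_atTop 0] with τ hτ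
        have : (τ : ℂ) ≠ 0 := by exact_mod_cast hτ.ne'
        simp only [Pi.div_apply, Function.comp]
        rw [mul_pow]
        field_simp
      have hlim2 : Tendsto (fun τ : ℝ => w.im * (Q.eval (τ * w) / (τ : ℂ) ^ Q.natDegree).im) atTop
          (𝓝 (w.im * (Q.leadingCoeff * w ^ Q.natDegree).im)) :=
        ((Complex.continuous_im.tendsto _).comp hlim).const_mul _
      have hlim3 : Tendsto (fun τ : ℝ => K / τ ^ (Q.natDegree + 1)) atTop (𝓝 0) :=
        tendsto_const_nhds.div_atTop (tendsto_pow_atTop (Nat.succ_ne_zero _))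
      have := le_of_tendsto_of_tendsto hlim2 hlim3 (by
        filter_upwards [eventually_gt_atTop 0] with τ hτ
        have h2 := h (τ * w) (by simp [hτ.ne', hw])
        rw [Complex.im_ofReal_mul] at h2
        rw [← Complex.ofReal_pow, Complex.div_ofReal_im, le_div_iff₀ (by positivity)]
        calc _ = τ * w.im * (Q.eval (τ * w)).im := by rw [pow_succ]; field_simp
          _ ≤ K := h2)
      rw [neg_mul, Complex.neg_im]
      linarith)
  refine ⟨Q.coeff 0, -Q.leadingCoeff.re, by simpa using hre.le, fun z => ?_⟩
  have hl : Q.leadingCoeff = (Q.leadingCoeff.re : ℂ) := by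
    apply Complex.ext <;> simp_all
  rw [Polynomial.eval_eq_sum_range, h1, Finset.sum_range_succ, Finset.sum_range_one]
  rw [Polynomial.leadingCoeff, h1] at *
  rw [hl]
  simp

/-- A reduced rational function `B / A` mapping the upper half-plane to the closed lower one and
commuting with conjugation has only simple real poles, with positive residues. -/
theorem Polynomial.residue_pos_of_im_mul_im_nonpos {A B : ℂ[X]}
    (h : ∀ z : ℂ, z.im * (B.eval z * conj (A.eval z)).im ≤ 0) {a : ℂ} {k : ℕ} (hk : 1 ≤ k)
    {R : ℂ[X]} (hA : A = (X - C a) ^ k * R) (hR : R.eval a ≠ 0) (hB : B.eval a ≠ 0) :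
    a.im = 0 ∧ k = 1 ∧ (B.eval a / R.eval a).im = 0 ∧ 0 < (B.eval a / R.eval a).re := by
  set c : ℂ := B.eval a * conj (R.eval a) with hc
  have hc0 : c ≠ 0 := mul_ne_zero hB (by simpa using hR)
  have hloc : ∀ w : ℂ, ∀ ε : ℝ, 0 < ε → (a.im + ε * w.im) *
      (B.eval (a + ε * w) * conj (R.eval (a + ε * w)) * conj w ^ k).im ≤ 0 := by
    intro w ε hε
    have := h (a + ε * w)
    rw [hA] at this
    simp only [eval_mul, eval_pow, eval_sub, eval_X, eval_C, add_sub_cancel_left, map_mul, map_pow,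
      Complex.conj_ofReal] at this
    rw [show B.eval (a + ε * w) * ((ε * conj w) ^ k * conj (R.eval (a + ε * w))) =
      ((ε ^ k : ℝ) : ℂ) * (B.eval (a + ε * w) * conj (R.eval (a + ε * w)) * conj w ^ k) by
        push_cast; ring, Complex.im_ofReal_mul, Complex.add_im, Complex.im_ofReal_mul] at this
    have hεk : 0 < ε ^ k := by positivity
    nlinarith
  have hlim : ∀ w : ℂ, Tendsto (fun ε : ℝ =>
      (B.eval (a + ε * w) * conj (R.eval (a + ε * w)) * conj w ^ k).im) (𝓝[>] 0)
      (𝓝 (c * conj w ^ k).im) := by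
    intro w
    have hcont : Continuous (fun ε : ℝ =>
        (B.eval (a + ε * w) * conj (R.eval (a + ε * w)) * conj w ^ k).im) := by
      fun_prop
    simpa [hc] using (hcont.tendsto 0).mono_left nhdsWithin_le_nhds
  have ha : a.im = 0 := by
    by_contra ha
    have hw : ∀ w : ℂ, a.im * (c * conj w ^ k).im ≤ 0 := by
      intro w
      have h1 : Tendsto (fun ε : ℝ => a.im + ε * w.im) (𝓝[>] 0) (𝓝 a.im) := by
        have hcont : Continuous (fun ε : ℝ => a.im + ε * w.im) := by fun_prop
        simpa using (hcont.tendsto 0).mono_left nhdsWithin_le_nhds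
      refine le_of_tendsto (h1.mul (hlim w)) ?_
      filter_upwards [self_mem_nhdsWithin] with ε hε using hloc w ε hε
    obtain ⟨w, hw'⟩ := IsAlgClosed.exists_pow_nat_eq (a.im * Complex.I / c) (Nat.pos_of_ne_zero
      (Nat.one_le_iff_ne_zero.1 hk))
    have := hw (conj w)
    rw [Complex.conj_conj, hw', mul_div_cancel₀ _ hc0, Complex.im_ofReal_mul, Complex.I_im] at this
    nlinarith [sq_pos_of_ne_zero ha]
  have hw : ∀ w : ℂ, 0 ≤ w.im * (c * w ^ k).im := by
    intro w
    have := le_of_tendsto ((hlim (conj w)).const_mul (conj w).im) (b := 0) (by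
      filter_upwards [self_mem_nhdsWithin] with ε hε
      have hε' : (0 : ℝ) < ε := hε
      have := hloc (conj w) ε hε
      rw [ha, zero_add, mul_assoc] at this
      exact nonpos_of_mul_nonpos_right this hε')
    rw [Complex.conj_conj, Complex.conj_im] at this
    linarith
  obtain ⟨hk1, him, hre⟩ := Complex.eq_one_and_pos_of_im_mul_im_mul_pow_nonneg hc0 hk hw
  have hdiv : B.eval a / R.eval a = c / ((Complex.normSq (R.eval a) : ℝ) : ℂ) := by
    rw [hc, Complex.normSq_eq_conj_mul_self, mul_comm (conj _)]
    have : conj (R.eval a) ≠ 0 := by simpa using hR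
    field_simp
  refine ⟨ha, hk1, ?_, ?_⟩
  · rw [hdiv, Complex.div_ofReal_im, him, zero_div]
  · rw [hdiv, Complex.div_ofReal_re]
    exact div_pos hre (Complex.normSq_pos.2 hR)

theorem Polynomial.exists_partialFractions_of_isCoprime {A B : ℂ[X]} (hA0 : A ≠ 0)
    (hcop : IsCoprime A B) (h : ∀ z : ℂ, z.im * (B.eval z * conj (A.eval z)).im ≤ 0) :
    ∃ (s : Finset ℂ) (r : ℂ → ℝ) (d : ℂ) (c : ℝ), 0 ≤ c ∧
      (∀ a ∈ s, a.im = 0 ∧ 0 ≤ r a ∧ A.eval a = 0) ∧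
      ∀ z, A.eval z ≠ 0 → B.eval z / A.eval z = d - c * z + ∑ a ∈ s, r a / (z - a) := by
  have hBroot : ∀ a, A.eval a = 0 → B.eval a ≠ 0 := by
    intro a ha hb
    obtain ⟨u, v, huv⟩ := hcop
    simpa [ha, hb] using congrArg (eval a) huv
  have hnodup : A.roots.Nodup := by
    rw [Multiset.nodup_iff_count_le_one]
    intro a
    rw [count_roots]
    by_contra hlt
    obtain ⟨R, hR, hnd⟩ := exists_eq_pow_rootMultiplicity_mul_and_not_dvd A hA0 a
    have ha : A.eval a = 0 := (rootMultiplicity_pos hA0).1 (by omega)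
    have := residue_pos_of_im_mul_im_nonpos h (by omega) hR
      (fun h0 => hnd (dvd_iff_isRoot.2 h0)) (hBroot a ha)
    omega
  set s := A.roots.toFinset with hs
  have hroot : ∀ a ∈ s, A.eval a = 0 := fun a ha =>
    (mem_roots hA0).1 (Multiset.mem_toFinset.1 ha)
  have hl : A.leadingCoeff ≠ 0 := leadingCoeff_ne_zero.2 hA0
  have hprod : A = C A.leadingCoeff * ∏ a ∈ s, (X - C a) := by
    conv_lhs => rw [(IsAlgClosed.splits A).eq_prod_roots]
    rw [Finset.prod, hs, Multiset.toFinset_val, hnodup.dedup]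
  obtain ⟨Q, ρ, hdeg, hpf⟩ := eq_quo_mul_prod_add_sum_rem_mul_prod (s := s)
    (C A.leadingCoeff⁻¹ * B) (g := fun a => X - C a) (fun a _ => monic_X_sub_C a)
    (fun a _ b _ hab => isCoprime_X_sub_C_of_isUnit_sub (sub_ne_zero.2 hab).isUnit)
  have hconst : ∀ a ∈ s, ρ a = C ((ρ a).coeff 0) := fun a ha => by
    apply eq_C_of_degree_le_zero
    have := hdeg a ha
    rw [degree_X_sub_C] at this
    exact Nat.WithBot.lt_one_iff_le_zero.1 this
  have hres : ∀ a ∈ s, a.im = 0 ∧ ((ρ a).coeff 0).im = 0 ∧ 0 < ((ρ a).coeff 0).re := by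
    intro a ha
    have hne : ∏ b ∈ s.erase a, (a - b) ≠ 0 :=
      Finset.prod_ne_zero_iff.2 fun b hb => sub_ne_zero.2 (Finset.ne_of_mem_erase hb).symm
    have hR : (C A.leadingCoeff * ∏ b ∈ s.erase a, (X - C b)).eval a =
        A.leadingCoeff * ∏ b ∈ s.erase a, (a - b) := by
      simp [eval_prod]
    have hval : B.eval a / (C A.leadingCoeff * ∏ b ∈ s.erase a, (X - C b)).eval a =
        (ρ a).coeff 0 := by
      rw [hR]
      have hev := congrArg (eval a) hpf
      rw [eval_add, eval_mul, eval_mul, eval_C, eval_prod, Finset.prod_eq_zero ha (by simp),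
        mul_zero, zero_add, eval_finsetSum, Finset.sum_eq_single_of_mem a ha, eval_mul,
        hconst a ha, eval_C, eval_prod] at hev
      · simp only [eval_sub, eval_X, eval_C] at hev
        rw [div_eq_iff (mul_ne_zero hl hne), mul_left_comm, ← hev]
        field_simp
      · intro b _ hba
        rw [eval_mul, eval_prod, Finset.prod_eq_zero (Finset.mem_erase.2 ⟨hba.symm, ha⟩) (by simp),
          mul_zero]
    have := residue_pos_of_im_mul_im_nonpos h le_rfl (a := a)
      (R := C A.leadingCoeff * ∏ b ∈ s.erase a, (X - C b)) (by
        conv_lhs => rw [hprod, ← Finset.mul_prod_erase s _ ha]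
        ring) (by rw [hR]; exact mul_ne_zero hl hne) (hBroot a (hroot a ha))
    rw [hval] at this
    exact ⟨this.1, this.2.2⟩
  have hfrac : ∀ z, A.eval z ≠ 0 →
      B.eval z / A.eval z = Q.eval z + ∑ a ∈ s, (((ρ a).coeff 0).re : ℂ) / (z - a) := by
    intro z hz
    have hAz : A.eval z = A.leadingCoeff * ∏ a ∈ s, (z - a) := by
      conv_lhs => rw [hprod]
      simp [eval_prod]
    have hne : ∏ a ∈ s, (z - a) ≠ 0 := fun h0 => hz (by rw [hAz, h0, mul_zero])
    have hev := congrArg (eval z) hpf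
    simp only [eval_add, eval_mul, eval_C, eval_prod, eval_finsetSum, eval_sub, eval_X] at hev
    have hB : B.eval z / A.eval z = (A.leadingCoeff⁻¹ * B.eval z) / ∏ a ∈ s, (z - a) := by
      rw [hAz]
      field_simp
    rw [hB, hev, add_div, mul_div_cancel_right₀ _ hne, Finset.sum_div]
    congr 1
    refine Finset.sum_congr rfl fun a ha => ?_
    have hza : z - a ≠ 0 := Finset.prod_ne_zero_iff.1 hne a ha
    have hne' : ∏ b ∈ s.erase a, (z - b) ≠ 0 :=
      Finset.prod_ne_zero_iff.2 fun b hb =>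
        Finset.prod_ne_zero_iff.1 hne b (Finset.mem_of_mem_erase hb)
    have hre : (((ρ a).coeff 0).re : ℂ) = (ρ a).coeff 0 :=
      Complex.ext (by simp) (by simp [(hres a ha).2.1])
    rw [← Finset.mul_prod_erase s _ ha, hre]
    conv_lhs => rw [hconst a ha]
    rw [eval_C]
    field_simp
  obtain ⟨d, c, hc, hQ⟩ := exists_affine_of_im_mul_im_le (Q := Q)
    (K := ∑ a ∈ s, ((ρ a).coeff 0).re) (by
      intro z hz
      have hAz : A.eval z ≠ 0 := fun h0 => hz (hres z (by simp [hs, hA0, h0])).1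
      have him : z.im * (B.eval z / A.eval z).im ≤ 0 := by
        rw [show B.eval z / A.eval z =
            B.eval z * conj (A.eval z) / ((Complex.normSq (A.eval z) : ℝ) : ℂ) by
          rw [Complex.normSq_eq_conj_mul_self, mul_comm (conj _)]
          have : conj (A.eval z) ≠ 0 := by simpa using hAz
          field_simp, Complex.div_ofReal_im, ← mul_div_assoc]
        exact div_nonpos_of_nonpos_of_nonneg (h z) (Complex.normSq_nonneg _)
      rw [hfrac z hAz, Complex.add_im, mul_add, Complex.im_sum, Finset.mul_sum] at him
      have hsum : -∑ a ∈ s, z.im * ((((ρ a).coeff 0).re : ℂ) / (z - a)).im ≤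
          ∑ a ∈ s, ((ρ a).coeff 0).re := by
        rw [← Finset.sum_neg_distrib]
        refine Finset.sum_le_sum fun a ha => ?_
        obtain ⟨haim, -, hpos⟩ := hres a ha
        have hsq : z.im ^ 2 ≤ Complex.normSq (z - a) := by
          rw [Complex.normSq_apply, Complex.sub_im, haim]
          nlinarith [mul_self_nonneg (z - a).re]
        have hz2 : 0 < z.im ^ 2 := by positivity
        rw [div_eq_mul_inv, Complex.im_ofReal_mul, Complex.inv_im, Complex.sub_im, haim, sub_zero,
          show -(z.im * (((ρ a).coeff 0).re * (-z.im / Complex.normSq (z - a)))) =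
            ((ρ a).coeff 0).re * (z.im ^ 2 / Complex.normSq (z - a)) by ring]
        exact mul_le_of_le_one_right hpos.le (div_le_one_of_le₀ hsq (hz2.le.trans hsq))
      linarith)
  exact ⟨s, fun a => ((ρ a).coeff 0).re, d, c, hc,
    fun a ha => ⟨(hres a ha).1, (hres a ha).2.2.le, hroot a ha⟩,
    fun z hz => by rw [hfrac z hz, hQ]⟩

theorem Polynomial.exists_partialFractions {A B : ℂ[X]} (hA0 : A ≠ 0)
    (h : ∀ z : ℂ, z.im * (B.eval z * conj (A.eval z)).im ≤ 0) :
    ∃ (s : Finset ℂ) (r : ℂ → ℝ) (d : ℂ) (c : ℝ), 0 ≤ c ∧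
      (∀ a ∈ s, a.im = 0 ∧ 0 ≤ r a ∧ A.eval a = 0) ∧
      ∀ z, A.eval z ≠ 0 → B.eval z / A.eval z = d - c * z + ∑ a ∈ s, r a / (z - a) := by
  classical
  set G := EuclideanDomain.gcd A B with hG
  obtain ⟨A', hA'⟩ : G ∣ A := EuclideanDomain.gcd_dvd_left A B
  obtain ⟨B', hB'⟩ : G ∣ B := EuclideanDomain.gcd_dvd_right A B
  have hG0 : G ≠ 0 := fun h0 => hA0 (by rw [hA', h0, zero_mul])
  have hA'0 : A' ≠ 0 := fun h0 => hA0 (by rw [hA', h0, mul_zero])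
  have hcop : IsCoprime A' B' := by
    refine ⟨EuclideanDomain.gcdA A B, EuclideanDomain.gcdB A B, mul_left_cancel₀ hG0 ?_⟩
    have := EuclideanDomain.gcd_eq_gcd_ab A B
    rw [← hG] at this
    calc _ = G * A' * EuclideanDomain.gcdA A B + G * B' * EuclideanDomain.gcdB A B := by ring
      _ = A * EuclideanDomain.gcdA A B + B * EuclideanDomain.gcdB A B := by rw [← hA', ← hB']
      _ = G * 1 := by rw [← this, mul_one]
  have h' : ∀ z : ℂ, z.im * (B'.eval z * conj (A'.eval z)).im ≤ 0 := by
    have hclosed : IsClosed {z : ℂ | z.im * (B'.eval z * conj (A'.eval z)).im ≤ 0} :=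
      isClosed_le (by fun_prop) continuous_const
    have hdense : Dense {z : ℂ | G.eval z = 0}ᶜ :=
      (finite_setOfPred_isRoot hG0).countable.dense_compl ℂ
    intro z
    refine hclosed.closure_subset_iff.2 ?_ (hdense z)
    intro z hz
    have := h z
    rw [hA', hB', eval_mul, eval_mul, map_mul,
      show G.eval z * B'.eval z * (conj (G.eval z) * conj (A'.eval z)) =
        ((Complex.normSq (G.eval z) : ℝ) : ℂ) * (B'.eval z * conj (A'.eval z)) by
      rw [Complex.normSq_eq_conj_mul_self]; ring, Complex.im_ofReal_mul, mul_left_comm] at this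
    exact nonpos_of_mul_nonpos_right this (Complex.normSq_pos.2 hz)
  obtain ⟨s, r, d, c, hc, hs, hf⟩ := exists_partialFractions_of_isCoprime hA'0 hcop h'
  refine ⟨s, r, d, c, hc, fun a ha => ⟨(hs a ha).1, (hs a ha).2.1, ?_⟩, fun z hz => ?_⟩
  · rw [hA', eval_mul, (hs a ha).2.2, mul_zero]
  · have hzA := hz
    rw [hA', eval_mul] at hzA
    rw [← hf z (right_ne_zero_of_mul hzA), hA', hB', eval_mul, eval_mul,
      mul_div_mul_left _ _ (left_ne_zero_of_mul hzA)]

/-- A rational function `B / A` mapping the upper half-plane to the closed lower one, commuting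
with conjugation and without poles on `[0, ∞)`, has nonpositive derivative on `[0, ∞)`, and its
tangent lines there lie below its value at `0`. -/
theorem Polynomial.deriv_div_nonpos_and_tangent_le {A B : ℂ[X]}
    (hA : ∀ t : ℝ, 0 ≤ t → A.eval (t : ℂ) ≠ 0)
    (h : ∀ z : ℂ, z.im * (B.eval z * conj (A.eval z)).im ≤ 0) {t : ℝ} (ht : 0 ≤ t) {D : ℂ}
    (hD : D = (B.derivative.eval (t : ℂ) * A.eval (t : ℂ) -
      B.eval (t : ℂ) * A.derivative.eval (t : ℂ)) / A.eval (t : ℂ) ^ 2) :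
    D.re ≤ 0 ∧ (B.eval (t : ℂ) / A.eval (t : ℂ)).re - t * D.re ≤
      (B.eval 0 / A.eval 0).re := by
  have hA0 : A ≠ 0 := by
    rintro rfl
    exact hA 0 le_rfl (by simp)
  obtain ⟨s, r, d, c, hc, hs, hf⟩ := exists_partialFractions hA0 h
  have hreal : ∀ a ∈ s, a = (a.re : ℂ) ∧ a.re < 0 := by
    intro a ha
    have hre : a = (a.re : ℂ) := Complex.ext (by simp) (by simp [(hs a ha).1])
    refine ⟨hre, ?_⟩
    by_contra hneg
    exact hA a.re (not_lt.1 hneg) (by rw [← hre]; exact (hs a ha).2.2)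
  have hne : ∀ a ∈ s, (t : ℂ) - a ≠ 0 := by
    intro a ha h0
    exact hA t ht (by rw [sub_eq_zero.1 h0]; exact (hs a ha).2.2)
  have hderiv : D = -c - ∑ a ∈ s, (r a : ℂ) / (t - a) ^ 2 := by
    have h1 : HasDerivAt (fun z : ℂ => B.eval z / A.eval z) D t := by
      rw [hD]
      exact (B.hasDerivAt _).div (A.hasDerivAt _) (hA t ht)
    have h2 : HasDerivAt (fun z : ℂ => d - c * z + ∑ a ∈ s, (r a : ℂ) / (z - a))
        (-c - ∑ a ∈ s, (r a : ℂ) / (t - a) ^ 2) t := by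
      rw [sub_eq_add_neg, ← Finset.sum_neg_distrib]
      refine HasDerivAt.add ?_ (HasDerivAt.fun_sum fun a ha => ?_)
      · simpa using ((hasDerivAt_id (t : ℂ)).const_mul (c : ℂ)).const_sub d
      · have := ((hasDerivAt_id (t : ℂ)).sub_const a).fun_inv (hne a ha)
        have := this.const_mul (r a : ℂ)
        simp only [id, ← div_eq_mul_inv] at this
        convert! this using 1
        ring
    refine h1.unique (h2.congr_of_eventuallyEq ?_)
    filter_upwards [A.continuous.continuousAt.eventually_ne (hA t ht)] with z hz using hf z hz
  have hDre : D.re = -c - ∑ a ∈ s, r a / (t - a.re) ^ 2 := by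
    have : D = ((-c - ∑ a ∈ s, r a / (t - a.re) ^ 2 : ℝ) : ℂ) := by
      rw [hderiv]
      push_cast
      congr 1
      exact Finset.sum_congr rfl fun a ha => by rw [← (hreal a ha).1]
    rw [this, Complex.ofReal_re]
  have hfre : ∀ u : ℝ, 0 ≤ u → (B.eval (u : ℂ) / A.eval (u : ℂ)).re =
      d.re - c * u + ∑ a ∈ s, r a / (u - a.re) := by
    intro u hu
    rw [hf u (hA u hu)]
    have : ∑ a ∈ s, (r a : ℂ) / (u - a) = ((∑ a ∈ s, r a / (u - a.re) : ℝ) : ℂ) := by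
      push_cast
      exact Finset.sum_congr rfl fun a ha => by rw [← (hreal a ha).1]
    rw [this, Complex.add_re, Complex.ofReal_re, Complex.sub_re, Complex.re_ofReal_mul,
      Complex.ofReal_re]
  constructor
  · rw [hDre]
    have : 0 ≤ ∑ a ∈ s, r a / (t - a.re) ^ 2 :=
      Finset.sum_nonneg fun a ha => div_nonneg (hs a ha).2.1 (sq_nonneg _)
    linarith
  · have h0 := hfre 0 le_rfl
    rw [Complex.ofReal_zero] at h0
    rw [h0, hfre t ht, hDre]
    have : ∑ a ∈ s, r a / (t - a.re) + t * ∑ a ∈ s, r a / (t - a.re) ^ 2 ≤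
        ∑ a ∈ s, r a / (0 - a.re) := by
      rw [Finset.mul_sum, ← Finset.sum_add_distrib]
      refine Finset.sum_le_sum fun a ha => ?_
      have hneg := (hreal a ha).2
      have h1 : 0 < t - a.re := by linarith
      have h2 : 0 < 0 - a.re := by linarith
      have hr := (hs a ha).2.1
      have : r a / (0 - a.re) - (r a / (t - a.re) + t * (r a / (t - a.re) ^ 2)) =
          r a * t ^ 2 / ((0 - a.re) * (t - a.re) ^ 2) := by
        field_simp
        ring
      have : 0 ≤ r a * t ^ 2 / ((0 - a.re) * (t - a.re) ^ 2) := by positivity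
      linarith
    linarith

end Univariate

section Multivariate

open Filter Topology ComplexConjugate

namespace MvPolynomial

theorem pderiv_pderiv_comm {σ R : Type*} [CommRing R] (i j : σ) (p : MvPolynomial σ R) :
    pderiv i (pderiv j p) = pderiv j (pderiv i p) := by
  classical
  have h : ⁅(pderiv i : Derivation R (MvPolynomial σ R) (MvPolynomial σ R)),
      (pderiv j : Derivation R (MvPolynomial σ R) (MvPolynomial σ R))⁆ = 0 := by
    refine derivation_ext fun k => ?_
    rw [Derivation.commutator_apply]
    have hconst : ∀ a b : σ, pderiv a (pderiv b (X k : MvPolynomial σ R)) = 0 := by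
      intro a b
      by_cases hb : b = k
      · subst hb
        simp
      · simp [pderiv_X_of_ne (Ne.symm hb)]
    rw [hconst, hconst, sub_zero, Derivation.zero_apply]
  have := congrArg (fun D => D p) h
  rwa [Derivation.commutator_apply, Derivation.zero_apply, sub_eq_zero] at this

variable {m : ℕ}

/-- The restriction of a real polynomial to the complex line `z ↦ w + z v`. -/
noncomputable def alongLine (w v : Fin m → ℂ) : MvPolynomial (Fin m) ℝ →ₐ[ℝ] Polynomial ℂ :=
  aeval fun l => Polynomial.C (w l) + Polynomial.C (v l) * Polynomial.X

theorem eval_alongLine (w v : Fin m → ℂ) (z : ℂ) (P : MvPolynomial (Fin m) ℝ) :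
    (alongLine w v P).eval z = aeval (fun l => w l + z * v l) P := by
  induction P using MvPolynomial.induction_on with
  | C a => simp [alongLine, Polynomial.algebraMap_apply]
  | add p q hp hq => simp [hp, hq]
  | mul_X p l hp => rw [map_mul, Polynomial.eval_mul, hp]; simp [alongLine, mul_comm z]

theorem eval_alongLine_ofReal (x v : Fin m → ℝ) (t : ℝ) (P : MvPolynomial (Fin m) ℝ) :
    (alongLine (fun l => (x l : ℂ)) (fun l => (v l : ℂ)) P).eval (t : ℂ) =
      (eval (fun l => x l + t * v l) P : ℝ) := by
  induction P using MvPolynomial.induction_on with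
  | C a => simp [alongLine, Polynomial.algebraMap_apply]
  | add p q hp hq => simp [hp, hq]
  | mul_X p l hp => rw [map_mul, Polynomial.eval_mul, hp]; simp [alongLine, mul_comm (t : ℂ)]

theorem derivative_alongLine_single (w : Fin m → ℂ) (j : Fin m) (P : MvPolynomial (Fin m) ℝ) :
    (alongLine w (Pi.single j 1) P).derivative = alongLine w (Pi.single j 1) (pderiv j P) := by
  induction P using MvPolynomial.induction_on with
  | C a => simp [alongLine, Polynomial.algebraMap_apply]
  | add p q hp hq => simp [hp, hq]
  | mul_X p l hp =>
    rw [map_mul, Polynomial.derivative_mul, hp, pderiv_mul, map_add, map_mul, map_mul, pderiv_X]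
    by_cases hl : l = j
    · subst hl
      simp [alongLine]
    · simp [alongLine, hl]

theorem aeval_conj (w : Fin m → ℂ) (P : MvPolynomial (Fin m) ℝ) :
    aeval (fun l => conj (w l)) P = conj (aeval w P) := by
  induction P using MvPolynomial.induction_on with
  | C a => simp
  | add p q hp hq => simp [hp, hq]
  | mul_X p l hp => simp [hp]

/-- A polynomial with real coefficients is upper stable if it has no zeros with all coordinates
in the open upper half-plane. -/
def IsUpperStable (P : MvPolynomial (Fin m) ℝ) : Prop :=
  ∀ w : Fin m → ℂ, (∀ i, 0 < (w i).im) → aeval w P ≠ 0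

theorem IsUpperStable.pderiv_eq_zero_or_im_div_neg {P : MvPolynomial (Fin m) ℝ}
    (hP : P.IsUpperStable) (i : Fin m) {w : Fin m → ℂ} (hw : ∀ i, 0 < (w i).im) :
    aeval w (pderiv i P) = 0 ∨ (aeval w (pderiv i P) / aeval w P).im < 0 := by
  have h0 : ∀ R : MvPolynomial (Fin m) ℝ, (alongLine w (Pi.single i 1) R).eval 0 = aeval w R := by
    intro R
    simp [eval_alongLine]
  have hne : (alongLine w (Pi.single i 1) P).eval 0 ≠ 0 := by
    rw [h0]
    exact hP w hw
  have hroots : ∀ ρ ∈ (alongLine w (Pi.single i 1) P).roots, (1 / (0 - ρ)).im < 0 := by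
    intro ρ hρ
    have hρ0 := (Polynomial.mem_roots'.1 hρ).2
    rw [Polynomial.IsRoot, eval_alongLine] at hρ0
    have him : ρ.im < 0 := by
      by_contra hneg
      refine hP _ (fun l => ?_) hρ0
      rw [Complex.add_im]
      refine add_pos_of_pos_of_nonneg (hw l) ?_
      by_cases hl : l = i
      · subst hl
        simpa using hneg
      · simp [hl]
    have hρne : ρ ≠ 0 := by
      rintro rfl
      simp at him
    rw [zero_sub, one_div, Complex.inv_im, Complex.neg_im, neg_neg]
    exact div_neg_of_neg_of_pos him (Complex.normSq_pos.2 (neg_ne_zero.2 hρne))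
  have hsum : ∀ M : Multiset ℂ, (∀ ρ ∈ M, (1 / (0 - ρ)).im < 0) →
      (M.map fun ρ => 1 / (0 - ρ)).sum = 0 ∨ (M.map fun ρ => 1 / (0 - ρ)).sum.im < 0 := by
    intro M
    induction M using Multiset.induction_on with
    | empty => simp
    | cons a M ih =>
      intro hM
      right
      rw [Multiset.map_cons, Multiset.sum_cons, Complex.add_im]
      have ha := hM a (Multiset.mem_cons_self a M)
      rcases ih fun ρ hρ => hM ρ (Multiset.mem_cons_of_mem hρ) with h | h
      · rw [h, Complex.zero_im]
        linarith
      · linarith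
  have hlog := (IsAlgClosed.splits
    (alongLine w (Pi.single i 1) P)).eval_derivative_div_eval_of_ne_zero hne
  rw [derivative_alongLine_single, h0, h0] at hlog
  rcases hsum _ hroots with h | h
  · left
    rw [h] at hlog
    exact (div_eq_zero_iff.1 hlog).resolve_right (hP w hw)
  · right
    rwa [hlog]

theorem IsUpperStable.sub_pderiv {P : MvPolynomial (Fin m) ℝ} (hP : P.IsUpperStable)
    (j : Fin m) : (P - pderiv j P).IsUpperStable := by
  intro w hw h0
  rw [map_sub, sub_eq_zero] at h0
  rcases hP.pderiv_eq_zero_or_im_div_neg j hw with h | h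
  · exact hP w hw (h0.trans h)
  · rw [← h0, div_self (hP w hw)] at h
    simp at h

theorem IsUpperStable.im_mul_im_alongLine_nonpos {P : MvPolynomial (Fin m) ℝ}
    (hP : P.IsUpperStable) (i : Fin m) (x : Fin m → ℝ) {v : Fin m → ℝ} (hv : 0 ≤ v) (z : ℂ) :
    z.im * ((alongLine (fun l => (x l : ℂ)) (fun l => (v l : ℂ)) (pderiv i P)).eval z *
      conj ((alongLine (fun l => (x l : ℂ)) (fun l => (v l : ℂ)) P).eval z)).im ≤ 0 := by
  have hupper : ∀ z : ℂ, 0 < z.im →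
      ((alongLine (fun l => (x l : ℂ)) (fun l => (v l : ℂ)) (pderiv i P)).eval z *
      conj ((alongLine (fun l => (x l : ℂ)) (fun l => (v l : ℂ)) P).eval z)).im ≤ 0 := by
    intro z hz
    set u : Fin m → ℂ := fun l => x l + z * v l with hu
    have hcont : Continuous fun ε : ℝ =>
        ((alongLine u (fun _ => Complex.I) (pderiv i P)).eval (ε : ℂ) *
          conj ((alongLine u (fun _ => Complex.I) P).eval (ε : ℂ))).im := by
      fun_prop
    have hlim := (hcont.tendsto 0).mono_left (nhdsWithin_le_nhds (s := Set.Ioi 0))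
    simp only [eval_alongLine, Complex.ofReal_zero, zero_mul, add_zero] at hlim
    rw [eval_alongLine, eval_alongLine]
    refine le_of_tendsto hlim ?_
    filter_upwards [self_mem_nhdsWithin] with ε hε
    have hε' : (0 : ℝ) < ε := hε
    have hw : ∀ l, 0 < (u l + ε * Complex.I).im := by
      intro l
      have := mul_nonneg hz.le (hv l)
      simp only [hu, Complex.add_im, Complex.ofReal_im, Complex.im_mul_ofReal,
        Complex.im_ofReal_mul, Complex.I_im]
      linarith
    set a := aeval (fun l => u l + ε * Complex.I) P with ha
    set b := aeval (fun l => u l + ε * Complex.I) (pderiv i P) with hb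
    rcases hP.pderiv_eq_zero_or_im_div_neg i hw with h | h
    · rw [← hb] at h
      simp [h]
    · rw [← ha, ← hb] at h
      have ha0 : a ≠ 0 := hP _ hw
      have : b * conj a = (Complex.normSq a : ℝ) * (b / a) := by
        rw [Complex.normSq_eq_conj_mul_self]
        field_simp
      rw [this, Complex.im_ofReal_mul]
      exact mul_nonpos_of_nonneg_of_nonpos (Complex.normSq_nonneg _) h.le
  have hconj : ∀ R : MvPolynomial (Fin m) ℝ,
      (alongLine (fun l => (x l : ℂ)) (fun l => (v l : ℂ)) R).eval (conj z) =
        conj ((alongLine (fun l => (x l : ℂ)) (fun l => (v l : ℂ)) R).eval z) := by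
    intro R
    rw [eval_alongLine, eval_alongLine, ← aeval_conj]
    simp
  rcases lt_trichotomy z.im 0 with hz | hz | hz
  · have := hupper (conj z) (by simpa using hz)
    rw [hconj, hconj, ← map_mul, Complex.conj_im] at this
    nlinarith
  · simp [hz]
  · exact mul_nonpos_of_nonneg_of_nonpos hz.le (hupper z hz)

/-- The barrier function of a stable polynomial is nonincreasing above its zeros. -/
theorem IsUpperStable.pderiv_div_le {P : MvPolynomial (Fin m) ℝ} (hP : P.IsUpperStable)
    {x y : Fin m → ℝ} (hx : ∀ y, x ≤ y → eval y P ≠ 0) (hxy : x ≤ y) (i : Fin m) :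
    eval y (pderiv i P) / eval y P ≤ eval x (pderiv i P) / eval x P := by
  have hv : 0 ≤ y - x := sub_nonneg.2 hxy
  obtain ⟨h1, h2⟩ := Polynomial.deriv_div_nonpos_and_tangent_le
    (A := alongLine (fun l => (x l : ℂ)) (fun l => ((y - x) l : ℂ)) P)
    (fun t ht => by
      rw [eval_alongLine_ofReal]
      exact_mod_cast hx _ fun l => le_add_of_nonneg_right (mul_nonneg ht (hv l)))
    (hP.im_mul_im_alongLine_nonpos i x hv) zero_le_one rfl
  have h0 := fun R : MvPolynomial (Fin m) ℝ => eval_alongLine_ofReal x (y - x) 0 R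
  simp only [Complex.ofReal_zero, zero_mul, add_zero] at h0
  replace h2 := (le_sub_self_iff _).2 (mul_nonpos_of_nonneg_of_nonpos zero_le_one h1) |>.trans h2
  rw [h0, h0, eval_alongLine_ofReal, eval_alongLine_ofReal, ← Complex.ofReal_div,
    ← Complex.ofReal_div, Complex.ofReal_re, Complex.ofReal_re] at h2
  have hy : (fun l => x l + 1 * (y - x) l) = y := by
    ext l
    simp
  rwa [hy] at h2

/-- The barrier function of a stable polynomial is nonincreasing and convex in each coordinate
direction above its zeros. -/
theorem IsUpperStable.pderiv_div_tangent {P : MvPolynomial (Fin m) ℝ} (hP : P.IsUpperStable)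
    {x y : Fin m → ℝ} (hx : ∀ y, x ≤ y → eval y P ≠ 0) (i j : Fin m) {t : ℝ} (ht : 0 ≤ t)
    (hy : y = x + Pi.single j t) {D : ℝ}
    (hD : D = (eval y (pderiv j (pderiv i P)) * eval y P -
      eval y (pderiv i P) * eval y (pderiv j P)) / eval y P ^ 2) :
    D ≤ 0 ∧ eval y (pderiv i P) / eval y P - t * D ≤ eval x (pderiv i P) / eval x P := by
  have hv : (0 : Fin m → ℝ) ≤ Pi.single j 1 := Pi.single_nonneg.2 zero_le_one
  have hcast : (fun l => ((Pi.single j 1 : Fin m → ℝ) l : ℂ)) = Pi.single j 1 := by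
    ext l
    by_cases hl : l = j
    · subst hl
      simp
    · simp [hl]
  have hy' : (fun l => x l + t * (Pi.single j 1 : Fin m → ℝ) l) = y := by
    ext l
    by_cases hl : l = j
    · subst hl
      simp [hy]
    · simp [hy, hl]
  have hevy := fun R : MvPolynomial (Fin m) ℝ => eval_alongLine_ofReal x (Pi.single j 1) t R
  have hevx := fun R : MvPolynomial (Fin m) ℝ => eval_alongLine_ofReal x (Pi.single j 1) 0 R
  have him := hP.im_mul_im_alongLine_nonpos i x hv
  simp only [hy', hcast] at hevy
  simp only [Complex.ofReal_zero, zero_mul, add_zero, hcast] at hevx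
  rw [hcast] at him
  obtain ⟨h1, h2⟩ := Polynomial.deriv_div_nonpos_and_tangent_le (D := (D : ℂ))
    (A := alongLine (fun l => (x l : ℂ)) (Pi.single j 1) P)
    (fun s hs => by
      rw [← hcast, eval_alongLine_ofReal]
      exact_mod_cast hx _ fun l => le_add_of_nonneg_right (mul_nonneg hs (hv l)))
    him ht (by
      rw [derivative_alongLine_single, derivative_alongLine_single, hevy, hevy, hevy, hevy, hD]
      push_cast
      rfl)
  rw [hevx, hevx, hevy, hevy, ← Complex.ofReal_div, ← Complex.ofReal_div, Complex.ofReal_re,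
    Complex.ofReal_re, Complex.ofReal_re] at h2
  exact ⟨h1, h2⟩

/-- The point `x` lies above the zeros of the stable polynomial `P`, and all barrier functions of
`P` at `x` are at most `1 - 1 / δ`. -/
structure IsBarrierPoint (P : MvPolynomial (Fin m) ℝ) (x : Fin m → ℝ) (δ : ℝ) : Prop where
  stable : P.IsUpperStable
  ne_zero : ∀ y, x ≤ y → eval y P ≠ 0
  barrier_le : ∀ i, eval x (pderiv i P) / eval x P + 1 / δ ≤ 1

theorem IsBarrierPoint.sub_pderiv {P : MvPolynomial (Fin m) ℝ} {x : Fin m → ℝ} {δ : ℝ}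
    (h : IsBarrierPoint P x δ) (hδ : 0 < δ) (j : Fin m) :
    IsBarrierPoint (P - pderiv j P) (x + Pi.single j δ) δ := by
  have hxle : x ≤ x + Pi.single j δ := le_add_of_nonneg_right (Pi.single_nonneg.2 hδ.le)
  have hδ' : 0 < 1 / δ := by positivity
  have hbar : ∀ y, x ≤ y → 1 / δ ≤ 1 - eval y (pderiv j P) / eval y P := fun y hy => by
    linarith [h.stable.pderiv_div_le h.ne_zero hy j, h.barrier_le j]
  refine ⟨h.stable.sub_pderiv j, fun y hy h0 => ?_, fun i => ?_⟩
  · have hy' := hxle.trans hy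
    have := hbar y hy'
    rw [map_sub, sub_eq_zero] at h0
    rw [← h0, div_self (h.ne_zero y hy')] at this
    linarith
  · set y := x + Pi.single j δ with hy
    obtain ⟨h1, h2⟩ := h.stable.pderiv_div_tangent h.ne_zero i j hδ.le hy rfl
    have h3 := hbar y hxle
    have ha := h.ne_zero y hxle
    have h4 := h.barrier_le i
    rw [map_sub, map_sub, map_sub, pderiv_pderiv_comm i j]
    set a := eval y P
    set b := eval y (pderiv i P)
    set c := eval y (pderiv j P)
    set e := eval y (pderiv j (pderiv i P))
    set D := (e * a - b * c) / a ^ 2 with hD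
    have hψ : 0 < 1 - c / a := hδ'.trans_le h3
    have hac : a - c ≠ 0 := by
      have : a - c = a * (1 - c / a) := by field_simp
      rw [this]
      exact mul_ne_zero ha hψ.ne'
    have hquot : (b - e) / (a - c) = b / a + -D / (1 - c / a) := by
      have : 1 - c / a = (a - c) / a := by field_simp
      rw [this, hD]
      field_simp
      ring
    have hle : -D / (1 - c / a) ≤ δ * -D := by
      rw [div_le_iff₀ hψ]
      have : 1 ≤ δ * (1 - c / a) := by
        rwa [div_le_iff₀' hδ] at h3
      nlinarith
    rw [hquot]
    linarith

theorem IsBarrierPoint.foldr_sub_pderiv {P : MvPolynomial (Fin m) ℝ} {x : Fin m → ℝ} {δ : ℝ}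
    (h : IsBarrierPoint P x δ) (hδ : 0 < δ) (L : List (Fin m)) :
    IsBarrierPoint (L.foldr (fun i Q => Q - pderiv i Q) P)
      (fun l => x l + L.count l * δ) δ := by
  induction L with
  | nil => simpa using h
  | cons j L ih =>
    have := ih.sub_pderiv hδ j
    rw [List.foldr_cons]
    convert this using 1
    ext l
    by_cases hl : l = j
    · subst hl
      simp
      ring
    · simp [hl, Ne.symm hl]

theorem eval_ofReal_map (y : Fin m → ℝ) (P : MvPolynomial (Fin m) ℝ) :
    eval (fun l => (y l : ℂ)) (map Complex.ofRealHom P) = (eval y P : ℝ) := by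
  induction P using MvPolynomial.induction_on with
  | C a => simp
  | add p q hp hq => simp [hp, hq]
  | mul_X p l hp => simp [hp]

end MvPolynomial

end Multivariate

/-- If the real stable polynomial `p` has no zeros in `{y : y ≥ x}` and
`Φ_p^j(x) + 1/δ ≤ 1` for every `j` (for some `δ > 0`), then `∏_i (1 - ∂_i) p` has no
zeros in `{y : y ≥ x + (δ, …, δ)}`. -/
theorem oneSubPderivProd_no_zeros (m : ℕ) (p : MvPolynomial (Fin m) ℂ)
    (hp : RealStable p) (x : Fin m → ℝ)
    (hx : ∀ y : Fin m → ℝ, x ≤ y → MvPolynomial.eval (fun l => ((y l : ℂ))) p ≠ 0)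
    (δ : ℝ) (hδ : 0 < δ)
    (hΦ : ∀ j : Fin m, barrier p j x + 1 / δ ≤ 1) :
    ∀ y : Fin m → ℝ, (∀ l, x l + δ ≤ y l) →
      MvPolynomial.eval (fun l => ((y l : ℂ))) (oneSubPderivProd p) ≠ 0 := by
  intro y hy
  obtain ⟨P, rfl⟩ : p ∈ Set.range (MvPolynomial.map (σ := Fin m) Complex.ofRealHom) := by
    rw [MvPolynomial.mem_range_map_iff_coeffs_subset]
    intro a ha
    obtain ⟨c, -, rfl⟩ := MvPolynomial.mem_coeffs_iff.1 ha
    obtain ⟨r, hr⟩ := hp.1 c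
    exact ⟨r, hr.symm⟩
  have hbar : MvPolynomial.IsBarrierPoint P x δ := by
    refine ⟨fun w hw => ?_, fun y hxy => ?_, fun j => ?_⟩
    · have := hp.2 w hw
      rwa [MvPolynomial.eval_map] at this
    · have := hx y hxy
      rw [MvPolynomial.eval_ofReal_map] at this
      exact_mod_cast this
    · have := hΦ j
      rwa [barrier, MvPolynomial.pderiv_map, MvPolynomial.eval_ofReal_map,
        MvPolynomial.eval_ofReal_map, ← Complex.ofReal_div, Complex.ofReal_re] at this
  have hmap : oneSubPderivProd (MvPolynomial.map Complex.ofRealHom P) =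
      MvPolynomial.map Complex.ofRealHom
        ((List.finRange m).foldr (fun i Q => Q - MvPolynomial.pderiv i Q) P) := by
    rw [oneSubPderivProd]
    induction List.finRange m with
    | nil => rfl
    | cons i L ih => rw [List.foldr_cons, List.foldr_cons, ih, MvPolynomial.pderiv_map, map_sub]
  rw [hmap, MvPolynomial.eval_ofReal_map]
  have := (hbar.foldr_sub_pderiv hδ (List.finRange m)).ne_zero y fun l => by
    beta_reduce
    rw [List.count_eq_one_of_mem (List.nodup_finRange m) (List.mem_finRange l)]
    simpa using hy l
  exact_mod_cast this
end
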